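/- Let L be a minimal bimodular lattice (i.e. L contains no vector of square 1) with d_+(L) + d_−(L) = 0. Then L is a root lattice: L is spanned over ℚ by its vectors of square 2. -/

import Mathlib

open scoped RealInnerProductSpace

noncomputable section

/-- The dual of a subset of Euclidean space: vectors pairing integrally with everything. -/
def dualSet {n : ℕ} (Λ : Set (EuclideanSpace ℝ (Fin n))) : Set (EuclideanSpace ℝ (Fin n)) :=
  {x | ∀ v ∈ Λ, ∃ k : ℤ, ⟪x, v⟫ = (k : ℝ)}

/-- A (positive definite integral) lattice of full rank `n` in `ℝ^n`: an additive subgroup,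
free abelian of rank `n` (it has a `ℤ`-basis indexed by `Fin n`), spanning `ℝ^n` over `ℝ`,
with all pairwise inner products integral. -/
def IsLattice {n : ℕ} (Λ : Set (EuclideanSpace ℝ (Fin n))) : Prop :=
  (0 ∈ Λ ∧ (∀ x ∈ Λ, ∀ y ∈ Λ, x + y ∈ Λ) ∧ (∀ x ∈ Λ, -x ∈ Λ)) ∧
  (∃ b : Fin n → EuclideanSpace ℝ (Fin n),
      (∀ i, b i ∈ Λ) ∧ LinearIndependent ℤ b ∧
      ∀ x ∈ Λ, ∃ c : Fin n → ℤ, x = ∑ i, (c i : ℝ) • b i) ∧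
  Submodule.span ℝ Λ = ⊤ ∧
  ∀ v ∈ Λ, ∀ w ∈ Λ, ∃ k : ℤ, ⟪v, w⟫ = (k : ℝ)

/-- A unimodular lattice: a lattice equal to its own dual. -/
def IsUnimodular {n : ℕ} (Λ : Set (EuclideanSpace ℝ (Fin n))) : Prop :=
  IsLattice Λ ∧ dualSet Λ = Λ

/-- A bimodular lattice: a lattice of index 2 in its dual. -/
def IsBimodular {n : ℕ} (Λ : Set (EuclideanSpace ℝ (Fin n))) : Prop :=
  IsLattice Λ ∧
  ∃ w ∈ dualSet Λ \ Λ, ∀ x ∈ dualSet Λ, x ∈ Λ ∨ x - w ∈ Λ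

/-- Characteristic covectors: elements `ξ` of the dual with `ξ·v ≡ v·v (mod 2)` for all `v ∈ Λ`. -/
def CharSet {n : ℕ} (Λ : Set (EuclideanSpace ℝ (Fin n))) : Set (EuclideanSpace ℝ (Fin n)) :=
  {ξ | ξ ∈ dualSet Λ ∧ ∀ v ∈ Λ, ∃ k : ℤ, ⟪ξ, v⟫ - ⟪v, v⟫ = 2 * (k : ℝ)}

/-- `CharSign Λ ε` (for `ε = ±1`): characteristic covectors with `ξ·ξ ≡ n + ε (mod 8)`. -/
def CharSign {n : ℕ} (Λ : Set (EuclideanSpace ℝ (Fin n))) (ε : ℤ) :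
    Set (EuclideanSpace ℝ (Fin n)) :=
  {ξ | ξ ∈ CharSet Λ ∧ ∃ k : ℤ, ⟪ξ, ξ⟫ = (n : ℝ) + (ε : ℝ) + 8 * (k : ℝ)}

/-- The defect `d(Λ) = min_{ξ ∈ Char(Λ)} (ξ·ξ − n)/4` of a full-rank lattice in `ℝ^n`. -/
def defect {n : ℕ} (Λ : Set (EuclideanSpace ℝ (Fin n))) : ℝ :=
  sInf ((fun ξ => (⟪ξ, ξ⟫ - (n : ℝ)) / 4) '' CharSet Λ)

/-- The two defects `d_±(L) = min_{ξ ∈ Char_±(L)} (ξ·ξ − n)/4` of a bimodular lattice. -/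
def defectSign {n : ℕ} (Λ : Set (EuclideanSpace ℝ (Fin n))) (ε : ℤ) : ℝ :=
  sInf ((fun ξ => (⟪ξ, ξ⟫ - (n : ℝ)) / 4) '' CharSign Λ ε)

/-- The juxtaposition `(x, y) ∈ ℝ^n × ℝ^m = ℝ^{n+m}`. -/
def pairE {n m : ℕ} (x : EuclideanSpace ℝ (Fin n)) (y : EuclideanSpace ℝ (Fin m)) :
    EuclideanSpace ℝ (Fin (n + m)) :=
  (EuclideanSpace.equiv (Fin (n + m)) ℝ).symm
    (Fin.append (EuclideanSpace.equiv (Fin n) ℝ x) (EuclideanSpace.equiv (Fin m) ℝ y))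

/-- The first component `ℝ^{n+m} → ℝ^n` of a covector. -/
def restFst {n m : ℕ} (ξ : EuclideanSpace ℝ (Fin (n + m))) : EuclideanSpace ℝ (Fin n) :=
  (EuclideanSpace.equiv (Fin n) ℝ).symm
    (fun i => EuclideanSpace.equiv (Fin (n + m)) ℝ ξ (Fin.castAdd m i))

/-- The second component `ℝ^{n+m} → ℝ^m` of a covector. -/
def restSnd {n m : ℕ} (ξ : EuclideanSpace ℝ (Fin (n + m))) : EuclideanSpace ℝ (Fin m) :=
  (EuclideanSpace.equiv (Fin m) ℝ).symm
    (fun i => EuclideanSpace.equiv (Fin (n + m)) ℝ ξ (Fin.natAdd n i))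

/-- The orthogonal direct sum `L ⊕ A ⊂ ℝ^{n+m}`, i.e. the subgroup `L × A`. -/
def prodSet {n m : ℕ} (L : Set (EuclideanSpace ℝ (Fin n))) (A : Set (EuclideanSpace ℝ (Fin m))) :
    Set (EuclideanSpace ℝ (Fin (n + m))) :=
  {z | ∃ x ∈ L, ∃ y ∈ A, z = pairE x y}

/-- The overlattice `U_A = (L × A) ∪ ((L' \ L) × (A' \ A)) ⊂ ℝ^{n+m}`. -/
def overLattice {n m : ℕ} (L : Set (EuclideanSpace ℝ (Fin n)))
    (A : Set (EuclideanSpace ℝ (Fin m))) : Set (EuclideanSpace ℝ (Fin (n + m))) :=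
  prodSet L A ∪ prodSet (dualSet L \ L) (dualSet A \ A)

/-- The standard lattice `I^n = ℤ^n ⊂ ℝ^n`. -/
def stdLattice (n : ℕ) : Set (EuclideanSpace ℝ (Fin n)) :=
  {x | ∀ i : Fin n, ∃ k : ℤ, x i = (k : ℝ)}

/-- A lattice is diagonal if it admits a `ℤ`-basis with Gram matrix `diag(1, …, 1, 2)`,
i.e. it is isomorphic to `Δ_n = I^{n-1} ⊕ A_1`. -/
def IsDiagonal {n : ℕ} (Λ : Set (EuclideanSpace ℝ (Fin n))) : Prop :=
  ∃ b : Fin n → EuclideanSpace ℝ (Fin n),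
    (∀ i, b i ∈ Λ) ∧ LinearIndependent ℤ b ∧
    (∀ x ∈ Λ, ∃ c : Fin n → ℤ, x = ∑ i, (c i : ℝ) • b i) ∧
    (∀ i j : Fin n, ⟪b i, b j⟫ =
      if i = j then (if (i : ℕ) = n - 1 then 2 else 1) else 0)

/-- A lattice has an orthonormal `ℤ`-basis iff it is isomorphic to the standard lattice `I^n`. -/
def HasOrthonormalZBasis {n : ℕ} (Λ : Set (EuclideanSpace ℝ (Fin n))) : Prop :=
  ∃ b : Fin n → EuclideanSpace ℝ (Fin n),
    (∀ i, b i ∈ Λ) ∧ LinearIndependent ℤ b ∧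
    (∀ x ∈ Λ, ∃ c : Fin n → ℤ, x = ∑ i, (c i : ℝ) • b i) ∧
    (∀ i j : Fin n, ⟪b i, b j⟫ = if i = j then 1 else 0)

section Poisson
open MeasureTheory

theorem tsum_int_translate_eq_tsum_fourier {ι : Type*} [Fintype ι] {g : (ι → ℝ) → ℂ}
    (hg : Continuous g) (hgi : Integrable g)
    (hu : ∀ R : ℝ, ∃ u : (ι → ℤ) → ℝ, Summable u ∧
      ∀ t : ι → ℝ, ‖t‖ ≤ R → ∀ n : ι → ℤ, ‖g (t + fun i => (n i : ℝ))‖ ≤ u n)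
    (hF : Summable fun k : ι → ℤ =>
      ∫ x : ι → ℝ, Complex.exp (-2 * Real.pi * Complex.I * ∑ i, (k i : ℂ) * x i) * g x)
    (t : ι → ℝ) :
    ∑' n : ι → ℤ, g (t + fun i => (n i : ℝ)) = ∑' k : ι → ℤ,
      (∫ x : ι → ℝ, Complex.exp (-2 * Real.pi * Complex.I * ∑ i, (k i : ℂ) * x i) * g x) *
        Complex.exp (2 * Real.pi * Complex.I * ∑ i, (k i : ℂ) * t i) := by
  classical
  set F : (ι → ℝ) → ℂ := fun t => ∑' n : ι → ℤ, g (t + fun i => (n i : ℝ)) with hFdef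
  have hFper : ∀ (t : ι → ℝ) (m : ι → ℤ), F (t + fun i => (m i : ℝ)) = F t := by
    intro t m
    simp only [hFdef]
    rw [← (Equiv.addLeft m).tsum_eq (fun n : ι → ℤ => g (t + fun i => (n i : ℝ)))]
    refine tsum_congr fun n => ?_
    congr 1
    ext i
    simp [add_assoc]
  have hFcont : Continuous F := by
    rw [continuous_iff_continuousAt]
    intro t
    obtain ⟨u, hus, hub⟩ := hu (‖t‖ + 1)
    have : ContinuousOn F (Metric.closedBall 0 (‖t‖ + 1)) := by
      refine continuousOn_tsum (fun n => by fun_prop) hus fun n x hx => ?_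
      exact hub x (by simpa using hx) n
    refine this.continuousAt (Metric.closedBall_mem_nhds_of_mem ?_)
    simp
  let p : (ι → ℝ) → UnitAddTorus ι := Pi.map fun _ x => (x : UnitAddCircle)
  have hp : IsOpenQuotientMap p :=
    IsOpenQuotientMap.piMap fun _ => QuotientAddGroup.isOpenQuotientMap_mk
  let s : UnitAddTorus ι → (ι → ℝ) := fun x i => (AddCircle.equivIoc 1 0 (x i)).1
  have hps : ∀ x, p (s x) = x := by
    intro x
    ext i
    exact (AddCircle.equivIoc 1 0).symm_apply_apply (x i)
  have hpF : ∀ t t', p t = p t' → F t = F t' := by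
    intro t t' h
    have : ∀ i, ∃ m : ℤ, t i = t' i + m := by
      intro i
      have h1 : ((t i : ℝ) : UnitAddCircle) = (t' i : ℝ) := congrFun h i
      have h2 : ((t i - t' i : ℝ) : UnitAddCircle) = 0 := by
        rw [AddCircle.coe_sub, h1, sub_self]
      obtain ⟨m, hm⟩ := (AddCircle.coe_eq_zero_iff 1).1 h2
      refine ⟨m, ?_⟩
      simp at hm
      linarith
    choose m hm using this
    rw [← hFper t' m]
    congr 1
    ext i
    exact hm i
  let G : C(UnitAddTorus ι, ℂ) := ⟨fun x => F (s x), by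
    rw [hp.isQuotientMap.continuous_iff]
    convert hFcont using 1
    ext t
    exact hpF _ _ (hps _)⟩
  have hG : ∀ t, G (p t) = F t := fun t => hpF _ _ (hps _)
  have hmF : ∀ (k : ι → ℤ) (x : ι → ℝ), UnitAddTorus.mFourier k (p x) =
      Complex.exp (2 * Real.pi * Complex.I * ∑ i, (k i : ℂ) * x i) := by
    intro k x
    simp only [UnitAddTorus.mFourier, ContinuousMap.coe_mk, Finset.mul_sum, Complex.exp_sum]
    refine Finset.prod_congr rfl fun i _ => ?_
    have := fourier_coe_apply (T := 1) (n := k i) (x := x i)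
    simp only [p, Pi.map_apply]
    rw [this]
    congr 1
    push_cast
    ring
  have hcoef : ∀ k : ι → ℤ, UnitAddTorus.mFourierCoeff G k =
      ∫ x : ι → ℝ, Complex.exp (-2 * Real.pi * Complex.I * ∑ i, (k i : ℂ) * x i) * g x := by
    intro k
    set h : (ι → ℝ) → ℂ := fun x =>
      Complex.exp (-2 * Real.pi * Complex.I * ∑ i, (k i : ℂ) * x i) * g x with hh
    have hhc : Continuous h := by fun_prop
    have hnorm : ∀ x, ‖h x‖ = ‖g x‖ := by
      intro x
      have : (-2 * Real.pi * Complex.I * ∑ i, (k i : ℂ) * x i : ℂ) =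
          ((-2 * Real.pi * ∑ i, (k i : ℝ) * x i : ℝ) : ℂ) * Complex.I := by
        push_cast; ring
      rw [hh]
      simp only
      rw [norm_mul, this, Complex.norm_exp_ofReal_mul_I, one_mul]
    have hhi : Integrable h :=
      hgi.congr' hhc.aestronglyMeasurable (Filter.Eventually.of_forall fun x => (hnorm x).symm)
    have hhper : ∀ (x : ι → ℝ) (n : ι → ℤ), h (x + fun i => (n i : ℝ)) =
        Complex.exp (-2 * Real.pi * Complex.I * ∑ i, (k i : ℂ) * x i) *
          g (x + fun i => (n i : ℝ)) := by
      intro x n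
      simp only [hh]
      congr 1
      rw [Complex.exp_eq_exp_iff_exists_int]
      refine ⟨-∑ i, k i * n i, ?_⟩
      push_cast [Pi.add_apply]
      simp only [mul_add, Finset.sum_add_distrib]
      ring
    let box : (ι → ℤ) → Set (ι → ℝ) := fun n => {x | ∀ i, x i ∈ Set.Ioc (n i : ℝ) (n i + 1)}
    have hbm : ∀ n, MeasurableSet (box n) := fun n =>
      MeasurableSet.univ_pi' fun i => measurableSet_Ioc
    have hbu : ⋃ n, box n = Set.univ := by
      refine Set.eq_univ_of_forall fun x => Set.mem_iUnion.2 ⟨fun i => ⌈x i⌉ - 1, fun i => ?_⟩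
      push_cast
      constructor
      · linarith [Int.ceil_lt_add_one (x i)]
      · linarith [Int.le_ceil (x i)]
    have hbd : Pairwise (Function.onFun Disjoint box) := by
      intro n m hnm
      refine Set.disjoint_left.2 fun x hx hx' => hnm ?_
      ext i
      obtain ⟨h1, h2⟩ := hx i
      obtain ⟨h3, h4⟩ := hx' i
      have h5 : (n i : ℝ) < m i + 1 := by linarith
      have h6 : (m i : ℝ) < n i + 1 := by linarith
      norm_cast at h5 h6
      omega
    have hbox0 : {x : ι → ℝ | ∀ i, x i ∈ Set.Ioc ((0 : ι → ℝ) i) ((0 : ι → ℝ) i + 1)} = box 0 := by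
      ext x; simp [box]
    have hvol : volume (box 0) < ⊤ := by
      have : box 0 = Set.univ.pi fun _ => Set.Ioc (0 : ℝ) 1 := by
        ext x; simp [box]
      rw [this, Real.volume_pi_Ioc]
      simp
    rw [UnitAddTorus.mFourierCoeff_eq_integral _ k 0, hbox0]
    have hR : ∫ x, h x = ∑' n : ι → ℤ, ∫ x in box 0, h (x + fun i => (n i : ℝ)) := by
      rw [← setIntegral_univ, ← hbu, integral_iUnion hbm hbd hhi.integrableOn]
      refine tsum_congr fun n => ?_
      have hmp := measurePreserving_add_right (volume : Measure (ι → ℝ)) (fun i => (n i : ℝ))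
      rw [← hmp.setIntegral_preimage_emb (measurableEmbedding_addRight _) h (box n)]
      congr 2
      ext x
      refine forall_congr' fun i => ?_
      simp only [Pi.add_apply, Pi.zero_apply, Set.mem_Ioc, Int.cast_zero]
      constructor <;> rintro ⟨h1, h2⟩ <;> constructor <;> linarith
    rw [hR]
    obtain ⟨u, hus, hub⟩ := hu 1
    have hle : ∀ n, ∀ x ∈ box 0, ‖h (x + fun i => (n i : ℝ))‖ ≤ u n := by
      intro n x hx
      rw [hnorm]
      refine hub x ?_ n
      rw [pi_norm_le_iff_of_nonneg zero_le_one]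
      intro i
      have := hx i
      simp only [Pi.zero_apply, Int.cast_zero, Set.mem_Ioc] at this
      rw [Real.norm_eq_abs, abs_le]
      constructor <;> linarith [this.1, this.2]
    rw [integral_tsum_of_summable_integral_norm (F := fun (n : ι → ℤ) x => h (x + fun i => (n i : ℝ)))]
    · refine setIntegral_congr_fun (hbm 0) fun x _ => ?_
      change UnitAddTorus.mFourier (-k) (p x) • G (p x) = _
      rw [hmF, hG, smul_eq_mul, hFdef]
      simp only
      rw [← tsum_mul_left]
      refine tsum_congr fun n => ?_
      rw [hhper]
      congr 2
      push_cast [Pi.neg_apply]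
      simp only [neg_mul, Finset.sum_neg_distrib]
      ring
    · intro n
      exact (hhi.comp_add_right _).integrableOn
    · refine Summable.of_nonneg_of_le (fun n => integral_nonneg fun _ => norm_nonneg _) (fun n => ?_)
        (hus.mul_right (volume.real (box 0)))
      have := norm_setIntegral_le_of_norm_le_const (μ := volume) (s := box 0)
        (f := fun x => ‖h (x + fun i => (n i : ℝ))‖) (C := u n) hvol
        (fun x hx => by simpa using hle n x hx)
      exact (le_abs_self _).trans this
  have := UnitAddTorus.hasSum_mFourier_series_apply_of_summable (f := G)
    (by simpa only [funext hcoef] using hF) (p t)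
  rw [hG] at this
  refine Eq.trans this.tsum_eq.symm ?_
  refine tsum_congr fun k => ?_
  rw [hcoef, hmF, smul_eq_mul]

end Poisson

section Lattice
variable {E : Type*} [NormedAddCommGroup E] [InnerProductSpace ℝ E]

/-- A subgroup of a Euclidean space which spans it and equals its own dual. -/
structure IsSelfDual (U : Submodule ℤ E) : Prop where
  span_top : Submodule.span ℝ (U : Set E) = ⊤
  mem_iff : ∀ x, x ∈ U ↔ ∀ v ∈ U, ∃ k : ℤ, ⟪x, v⟫ = k

/-- A characteristic vector of an integral lattice. -/
def IsCharVec (U : Submodule ℤ E) (ξ : E) : Prop :=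
  ξ ∈ U ∧ ∀ v ∈ U, ∃ k : ℤ, ⟪ξ, v⟫ - ⟪v, v⟫ = 2 * k

variable {U : Submodule ℤ E}

theorem IsSelfDual.inner_int (hU : IsSelfDual U) {x v : E} (hx : x ∈ U) (hv : v ∈ U) :
    ∃ k : ℤ, ⟪x, v⟫ = k :=
  (hU.mem_iff x).1 hx v hv

theorem IsSelfDual.one_le_norm (hU : IsSelfDual U) {x : E} (hx : x ∈ U) (h0 : x ≠ 0) :
    1 ≤ ‖x‖ := by
  obtain ⟨k, hk⟩ := hU.inner_int hx hx
  have h1 : 0 < ⟪x, x⟫ := real_inner_self_pos.2 h0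
  rw [hk] at h1
  have h2 : (1 : ℤ) ≤ k := by exact_mod_cast h1
  have h3 : (1 : ℝ) ≤ ‖x‖ ^ 2 := by
    rw [← real_inner_self_eq_norm_sq, hk]; exact_mod_cast h2
  nlinarith [norm_nonneg x]

theorem IsSelfDual.discreteTopology (hU : IsSelfDual U) : DiscreteTopology U := by
  refine DiscreteTopology.of_forall_le_dist (r := 1) one_pos fun x y hxy => ?_
  change 1 ≤ dist (x : E) y
  rw [dist_eq_norm]
  exact hU.one_le_norm (U.sub_mem x.2 y.2) (sub_ne_zero.2 fun h => hxy (Subtype.ext h))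

variable [FiniteDimensional ℝ E]

theorem exists_dual_family {ι : Type*} [Finite ι] [DecidableEq ι] (b : Module.Basis ι ℝ E) :
    ∃ b' : ι → E, ∀ i x, ⟪b' i, x⟫ = b.repr x i := by
  refine ⟨fun i => (InnerProductSpace.toDual ℝ E).symm (b.coord i).toContinuousLinearMap, ?_⟩
  intro i x
  rw [InnerProductSpace.toDual_symm_apply]
  simp

omit [FiniteDimensional ℝ E] in
theorem eq_sum_dual_family {ι : Type*} [Fintype ι] {b : Module.Basis ι ℝ E}
    {b' : ι → E} (h : ∀ i x, ⟪b' i, x⟫ = b.repr x i) (x : E) :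
    x = ∑ i, ⟪x, b i⟫ • b' i := by
  classical
  refine ext_inner_right ℝ fun v => ?_
  conv_lhs => rw [← b.sum_repr v]
  simp only [sum_inner, inner_sum, real_inner_smul_left, real_inner_smul_right, h]
  exact Finset.sum_congr rfl fun i _ => mul_comm _ _

theorem IsSelfDual.exists_basis (hU : IsSelfDual U) :
    ∃ (b : Module.Basis (Fin (Module.finrank ℝ E)) ℝ E) (b' : Fin (Module.finrank ℝ E) → E),
      (∀ i x, ⟪b' i, x⟫ = b.repr x i) ∧
      (∀ x, x ∈ U ↔ ∃ c : Fin (Module.finrank ℝ E) → ℤ, x = ∑ i, (c i : ℝ) • b i) ∧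
      (∀ x, x ∈ U ↔ ∃ c : Fin (Module.finrank ℝ E) → ℤ, x = ∑ i, (c i : ℝ) • b' i) := by
  have := hU.discreteTopology
  have : IsZLattice ℝ U := ⟨hU.span_top⟩
  have : Module.Finite ℤ U := ZLattice.module_finite ℝ U
  have : Module.Free ℤ U := ZLattice.module_free ℝ U
  let b0 := Module.finBasisOfFinrankEq ℤ U (ZLattice.rank ℝ U)
  let b := b0.ofZLatticeBasis ℝ U
  obtain ⟨b', hb'⟩ := exists_dual_family b
  have h1 : ∀ x, x ∈ U ↔ ∃ c : Fin (Module.finrank ℝ E) → ℤ, x = ∑ i, (c i : ℝ) • b i := by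
    intro x
    rw [← b0.ofZLatticeBasis_span ℝ, Submodule.mem_span_range_iff_exists_fun]
    refine exists_congr fun c => ?_
    rw [eq_comm]
    simp only [Int.cast_smul_eq_zsmul]
    rfl
  refine ⟨b, b', hb', h1, fun x => ⟨fun hx => ?_, ?_⟩⟩
  · have hbU : ∀ i, b i ∈ U := fun i => by
      rw [Module.Basis.ofZLatticeBasis_apply]; exact (b0 i).2
    choose c hc using fun i => hU.inner_int hx (hbU i)
    refine ⟨c, ?_⟩
    simp only [← hc]
    exact eq_sum_dual_family hb' x
  · rintro ⟨c, rfl⟩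
    rw [hU.mem_iff]
    intro v hv
    obtain ⟨d, rfl⟩ := (h1 v).1 hv
    refine ⟨∑ i, c i * d i, ?_⟩
    rw [sum_inner]
    push_cast
    refine Finset.sum_congr rfl fun i _ => ?_
    rw [real_inner_smul_left, hb', ← b.equivFun_apply, map_sum]
    simp [Finsupp.single_apply]

theorem IsSelfDual.exists_isCharVec (hU : IsSelfDual U) : ∃ ξ, IsCharVec U ξ := by
  obtain ⟨b, b', hb', h1, h2⟩ := hU.exists_basis
  have hbU : ∀ i, b i ∈ U := fun i =>
    (h1 _).2 ⟨Pi.single i 1, by classical simp [Pi.single_apply, ite_smul]⟩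
  choose N hN using fun i j => hU.inner_int (hbU i) (hbU j)
  refine ⟨∑ i, (N i i : ℝ) • b' i, (h2 _).2 ⟨_, rfl⟩, fun v hv => ?_⟩
  obtain ⟨c, rfl⟩ := (h1 v).1 hv
  have key : ∀ s : Finset (Fin (Module.finrank ℝ E)), ∃ k : ℤ,
      (∑ i ∈ s, (N i i : ℝ) * c i) - ⟪∑ i ∈ s, (c i : ℝ) • b i, ∑ i ∈ s, (c i : ℝ) • b i⟫
        = 2 * k := by
    classical
    intro s
    induction s using Finset.induction_on with
    | empty => exact ⟨0, by simp⟩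
    | insert a s ha ih =>
      obtain ⟨k, hk⟩ := ih
      obtain ⟨l, hl⟩ := hU.inner_int (x := b a) (v := ∑ i ∈ s, (c i : ℝ) • b i) (hbU a)
        (U.sum_mem fun i _ => by
          rw [Int.cast_smul_eq_zsmul]; exact U.smul_mem _ (hbU i))
      obtain ⟨e, he⟩ : ∃ e : ℤ, c a - c a * c a = 2 * e := by
        have : Even (c a * (c a - 1)) := Int.even_mul_pred_self _
        obtain ⟨e, he⟩ := this
        exact ⟨-e, by linarith⟩
      have he' : (c a : ℝ) - c a * c a = 2 * e := by exact_mod_cast he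
      refine ⟨k + N a a * e - c a * l, ?_⟩
      rw [Finset.sum_insert ha, Finset.sum_insert ha, inner_add_add_self]
      rw [real_inner_smul_left, real_inner_smul_right, real_inner_smul_left,
        real_inner_smul_right, hl, hN]
      push_cast
      have hl' := (real_inner_comm (b a) (∑ i ∈ s, (c i : ℝ) • b i)).trans hl
      linear_combination hk + (N a a : ℝ) * he' - (c a : ℝ) * hl'
  obtain ⟨k, hk⟩ := key Finset.univ
  refine ⟨k, hk ▸ ?_⟩
  rw [sum_inner]
  congr 1
  refine Finset.sum_congr rfl fun i _ => ?_
  rw [real_inner_smul_left, hb', ← b.equivFun_apply, map_sum]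
  simp [Finsupp.single_apply]

theorem IsSelfDual.summable_exp_neg (hU : IsSelfDual U) {a : ℝ} (ha : 0 < a) :
    Summable fun v : U => Real.exp (-a * ‖(v : E)‖ ^ 2) := by
  classical
  have := hU.discreteTopology
  have hs := ZLattice.summable_norm_rpow U (-(2 * (Module.finrank ℤ U + 1) : ℕ) : ℝ)
    (by push_cast; linarith [(Nat.cast_nonneg (Module.finrank ℤ U) : (0:ℝ) ≤ _)])
  set k := Module.finrank ℤ U + 1
  refine Summable.of_nonneg_of_le (fun _ => (Real.exp_pos _).le) (fun v => ?_)
    ((hs.mul_left (k.factorial / a ^ k)).add (summable_of_hasFiniteSupport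
      (f := fun v : U => if v = 0 then (1 : ℝ) else 0)
      ((Set.finite_singleton 0).subset fun v hv => by
        by_contra h; exact hv (if_neg h))))
  by_cases hv : v = 0
  · subst hv
    simp only [ZeroMemClass.coe_zero, norm_zero, if_true]
    simp
  · have hp : 0 < ‖(v : E)‖ := norm_pos_iff.2 fun h => hv (Subtype.ext h)
    have h1 := Real.pow_div_factorial_le_exp (x := a * ‖(v : E)‖ ^ 2) (by positivity) k
    rw [if_neg hv, add_zero, Real.rpow_neg (by positivity), Real.rpow_natCast, neg_mul,
      Real.exp_neg, Submodule.coe_norm]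
    rw [inv_le_comm₀ (Real.exp_pos _) (by positivity)]
    refine le_trans (le_of_eq ?_) h1
    rw [mul_pow, ← pow_mul]
    field_simp

end Lattice

section PoissonLattice
open MeasureTheory

theorem exists_integral_comp_equiv_eq {ι E : Type*} [Fintype ι] [NormedAddCommGroup E]
    [InnerProductSpace ℝ E] [FiniteDimensional ℝ E] [MeasurableSpace E] [BorelSpace E]
    (B : (ι → ℝ) ≃L[ℝ] E) :
    ∃ c : ℝ, ∀ f : E → ℂ, (Integrable f → Integrable fun x => f (B x)) ∧
      ∫ x, f (B x) = c * ∫ v, f v := by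
  have h := Measure.isAddLeftInvariant_eq_smul
    (Measure.map B (volume : Measure (ι → ℝ))) (volume : Measure E)
  set c := Measure.addHaarScalarFactor (Measure.map B (volume : Measure (ι → ℝ)))
    (volume : Measure E)
  let e := B.toHomeomorph.toMeasurableEquiv
  refine ⟨c, fun f => ⟨fun hf => ?_, ?_⟩⟩
  · have h1 : Integrable f (Measure.map B volume) := by
      rw [h]; exact hf.smul_measure (by simp)
    exact (integrable_map_equiv e f).1 h1
  · refine (integral_map_equiv e f).symm.trans ?_
    change ∫ v, f v ∂(Measure.map B volume) = _
    rw [h, integral_smul_nnreal_measure]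
    rfl

theorem norm_cexp_gaussian (τ : ℂ) (r : ℝ) :
    ‖Complex.exp (Real.pi * Complex.I * τ * (r : ℂ) ^ 2)‖ = Real.exp (-(Real.pi * τ.im) * r ^ 2) := by
  rw [Complex.norm_exp]
  congr 1
  have : (Real.pi * Complex.I * τ * (r : ℂ) ^ 2 : ℂ) = ((Real.pi * r ^ 2 : ℝ) : ℂ) * (Complex.I * τ) := by
    push_cast; ring
  rw [this, Complex.re_ofReal_mul]
  simp
  ring

theorem neg_inv_im_pos {τ : ℂ} (hτ : 0 < τ.im) : 0 < (-1 / τ).im := by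
  have := UpperHalfPlane.im_inv_neg_coe_pos ⟨τ, hτ⟩
  convert this using 2
  change -1 / τ = (-τ)⁻¹
  rw [inv_neg, neg_div, one_div]

variable {E : Type*} [NormedAddCommGroup E] [InnerProductSpace ℝ E] [FiniteDimensional ℝ E]
variable {U : Submodule ℤ E}

theorem IsSelfDual.exists_const_poisson (hU : IsSelfDual U) :
    ∃ c : ℂ, ∀ (τ : ℂ), 0 < τ.im → ∀ y : E,
      ∑' v : U, Complex.exp (Real.pi * Complex.I * τ * (‖(v : E) + y‖ : ℂ) ^ 2) =
        c * ((Complex.I / τ) ^ (Module.finrank ℝ E / 2 : ℂ) *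
          ∑' w : U, Complex.exp (Real.pi * Complex.I * (-1 / τ) * (‖(w : E)‖ : ℂ) ^ 2
            + 2 * Real.pi * Complex.I * (⟪(w : E), y⟫ : ℝ))) := by
  borelize E
  have hb := hU.exists_basis
  generalize hm : Module.finrank ℝ E = m at hb ⊢
  obtain ⟨b, b', hb', h1, h2⟩ := hb
  let B : (Fin m → ℝ) ≃L[ℝ] E := b.equivFun.symm.toContinuousLinearEquiv
  have hB : ∀ x, B x = ∑ i, x i • b i := fun x => b.equivFun_symm_apply x
  have hBr : ∀ x i, ⟪b' i, B x⟫ = x i := by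
    intro x i
    rw [hb', ← b.equivFun_apply]
    exact congrFun (b.equivFun.apply_symm_apply x) i
  obtain ⟨c, hc⟩ := exists_integral_comp_equiv_eq B
  let e₁ : (Fin m → ℤ) ≃ U := Equiv.ofBijective
    (fun n => ⟨∑ i, (n i : ℝ) • b i, (h1 _).2 ⟨n, rfl⟩⟩) (by
      refine ⟨fun n n' h => ?_, fun v => ?_⟩
      · have h3 : B (fun i => (n i : ℝ)) = B (fun i => (n' i : ℝ)) := by
          rw [hB, hB]; exact congrArg Subtype.val h
        ext i
        exact_mod_cast congrFun (B.injective h3) i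
      · obtain ⟨n, hn⟩ := (h1 v).1 v.2
        exact ⟨n, Subtype.ext hn.symm⟩)
  have he₁ : ∀ n, (e₁ n : E) = B (fun i => (n i : ℝ)) := fun n => (hB _).symm
  have hin : ∀ (k : Fin m → ℤ) x, ⟪∑ i, (k i : ℝ) • b' i, B x⟫ = ∑ i, (k i : ℝ) * x i := by
    intro k x
    rw [sum_inner]
    exact Finset.sum_congr rfl fun i _ => by rw [real_inner_smul_left, hBr]
  let e₂ : (Fin m → ℤ) ≃ U := Equiv.ofBijective
    (fun n => ⟨∑ i, (n i : ℝ) • b' i, (h2 _).2 ⟨n, rfl⟩⟩) (by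
      refine ⟨fun n n' h => ?_, fun v => ?_⟩
      · have h3 := congrArg Subtype.val h
        ext i
        have h4 := hin n (Pi.single i 1)
        simp only at h3
        rw [h3, hin] at h4
        simp [Pi.single_apply] at h4
        exact h4.symm
      · obtain ⟨n, hn⟩ := (h2 v).1 v.2
        exact ⟨n, Subtype.ext hn.symm⟩)
  have he₂ : ∀ k x, ⟪(e₂ k : E), B x⟫ = ∑ i, (k i : ℝ) * x i := hin
  refine ⟨c, fun τ hτ y => ?_⟩
  set g : (Fin m → ℝ) → ℂ := fun x => Complex.exp (Real.pi * Complex.I * τ * (‖B x‖ : ℂ) ^ 2) with hg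
  have hre : 0 < (-(Real.pi * Complex.I * τ)).re := by
    simp only [Complex.neg_re, Complex.mul_re, Complex.mul_im, Complex.ofReal_re, Complex.ofReal_im,
      Complex.I_re, Complex.I_im]
    simp
    positivity
  have hτ0 : τ ≠ 0 := by rintro rfl; simp at hτ
  have hgc : Continuous g := by fun_prop
  have hgi : Integrable g := by
    refine (hc (fun v => Complex.exp (Real.pi * Complex.I * τ * (‖v‖ : ℂ) ^ 2))).1 ?_
    have := GaussianFourier.integrable_cexp_neg_mul_sq_norm_add (V := E) hre 0 0
    simpa using this
  have hgu : ∀ R : ℝ, ∃ u : (Fin m → ℤ) → ℝ, Summable u ∧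
      ∀ t : Fin m → ℝ, ‖t‖ ≤ R → ∀ n : Fin m → ℤ, ‖g (t + fun i => (n i : ℝ))‖ ≤ u n := by
    intro R
    have hs := hU.summable_exp_neg (a := Real.pi * τ.im / 2) (by positivity)
    refine ⟨fun n => Real.exp (Real.pi * τ.im * (‖(B : (Fin m → ℝ) →L[ℝ] E)‖ * R) ^ 2) *
      Real.exp (-(Real.pi * τ.im / 2) * ‖(e₁ n : E)‖ ^ 2),
      (e₁.summable_iff.2 hs).mul_left _, fun t ht n => ?_⟩
    rw [hg]
    simp only
    rw [norm_cexp_gaussian, ← Real.exp_add, Real.exp_le_exp, he₁, map_add]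
    have h3 : ‖B t‖ ≤ ‖(B : (Fin m → ℝ) →L[ℝ] E)‖ * R :=
      ((B : (Fin m → ℝ) →L[ℝ] E).le_opNorm t).trans (by gcongr)
    set N := B (fun i => (n i : ℝ))
    have h4 : ‖N‖ ≤ ‖B t + N‖ + ‖B t‖ := by
      have := norm_sub_le (B t + N) (B t)
      simpa using this
    have h5 : ‖N‖ ^ 2 ≤ 2 * ‖B t + N‖ ^ 2 + 2 * (‖(B : (Fin m → ℝ) →L[ℝ] E)‖ * R) ^ 2 := by
      have h6 : ‖N‖ ^ 2 ≤ (‖B t + N‖ + ‖B t‖) ^ 2 := by gcongr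
      have h7 : ‖B t‖ ^ 2 ≤ (‖(B : (Fin m → ℝ) →L[ℝ] E)‖ * R) ^ 2 := by gcongr
      nlinarith [sq_nonneg (‖B t + N‖ - ‖B t‖)]
    have h8 : 0 < Real.pi * τ.im := by positivity
    nlinarith
  have hcoef : ∀ k : Fin m → ℤ,
      ∫ x : Fin m → ℝ, Complex.exp (-2 * Real.pi * Complex.I * ∑ i, (k i : ℂ) * x i) * g x =
      c * ((Complex.I / τ) ^ (m / 2 : ℂ) *
        Complex.exp (Real.pi * Complex.I * (-1 / τ) * (‖(e₂ k : E)‖ : ℂ) ^ 2)) := by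
    intro k
    have h3 := (hc (fun v => Complex.exp (-(-(Real.pi * Complex.I * τ)) * (‖v‖ : ℂ) ^ 2 +
      (-2 * Real.pi * Complex.I) * (⟪(e₂ k : E), v⟫ : ℝ)))).2
    rw [GaussianFourier.integral_cexp_neg_mul_sq_norm_add hre, hm] at h3
    convert h3 using 1
    · refine integral_congr_ae (Filter.Eventually.of_forall fun x => ?_)
      simp only [hg]
      rw [← Complex.exp_add, he₂]
      congr 1
      push_cast
      ring
    · have hI : Complex.I ^ 2 = -1 := Complex.I_sq
      have hp : (Real.pi : ℂ) ≠ 0 := by exact_mod_cast Real.pi_ne_zero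
      congr 3
      · field_simp
        rw [hI]
      · field_simp
        ring
  have hF : Summable fun k : Fin m → ℤ =>
      ∫ x : Fin m → ℝ, Complex.exp (-2 * Real.pi * Complex.I * ∑ i, (k i : ℂ) * x i) * g x := by
    simp only [hcoef]
    refine (Summable.mul_left _ ?_).mul_left _
    refine Summable.of_norm ?_
    simp only [norm_cexp_gaussian]
    exact e₂.summable_iff.2 (hU.summable_exp_neg (mul_pos Real.pi_pos (neg_inv_im_pos hτ)))
  have key := tsum_int_translate_eq_tsum_fourier hgc hgi hgu hF (B.symm y)
  rw [← e₁.tsum_eq, ← e₂.tsum_eq, ← tsum_mul_left, ← tsum_mul_left]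
  convert key using 1
  · refine tsum_congr fun n => ?_
    simp only [hg, map_add, he₁]
    rw [add_comm, B.apply_symm_apply]
  · refine tsum_congr fun k => ?_
    rw [hcoef, Complex.exp_add]
    have := he₂ k (B.symm y)
    rw [B.apply_symm_apply] at this
    rw [this]
    push_cast
    ring

theorem IsSelfDual.poisson (hU : IsSelfDual U) {τ : ℂ} (hτ : 0 < τ.im) (y : E) :
    ∑' v : U, Complex.exp (Real.pi * Complex.I * τ * (‖(v : E) + y‖ : ℂ) ^ 2) =
      (Complex.I / τ) ^ (Module.finrank ℝ E / 2 : ℂ) *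
        ∑' w : U, Complex.exp (Real.pi * Complex.I * (-1 / τ) * (‖(w : E)‖ : ℂ) ^ 2
          + 2 * Real.pi * Complex.I * (⟪(w : E), y⟫ : ℝ)) := by
  obtain ⟨c, hc⟩ := hU.exists_const_poisson
  have h := hc Complex.I (by simp) 0
  have hI : (-1 / Complex.I : ℂ) = Complex.I := by
    rw [neg_div, one_div, Complex.inv_I, neg_neg]
  simp only [add_zero, inner_zero_right, Complex.ofReal_zero, mul_zero, hI,
    div_self Complex.I_ne_zero, Complex.one_cpow, one_mul] at h
  have hpos : ∑' v : U, Complex.exp (Real.pi * Complex.I * Complex.I * (‖(v : E)‖ : ℂ) ^ 2) ≠ 0 := by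
    have h1 : ∀ v : U, Complex.exp (Real.pi * Complex.I * Complex.I * (‖(v : E)‖ : ℂ) ^ 2) =
        (Real.exp (-Real.pi * ‖(v : E)‖ ^ 2) : ℝ) := by
      intro v
      push_cast
      congr 1
      linear_combination (Real.pi : ℂ) * (‖(v : E)‖ : ℂ) ^ 2 * Complex.I_sq
    simp only [h1]
    rw [← Complex.ofReal_tsum, Complex.ofReal_ne_zero]
    exact ((hU.summable_exp_neg Real.pi_pos).tsum_pos (fun _ => (Real.exp_pos _).le) 0
      (Real.exp_pos _)).ne'
  have hc1 : c = 1 := by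
    rw [eq_comm, mul_eq_right₀ hpos] at h
    exact h
  rw [hc τ hτ y, hc1, one_mul]

end PoissonLattice

section Theta
variable {E : Type*} [NormedAddCommGroup E] [InnerProductSpace ℝ E]

/-- The theta series of the translate `U + y`. -/
def latticeTheta (U : Submodule ℤ E) (y : E) (τ : ℂ) : ℂ :=
  ∑' v : U, Complex.exp (Real.pi * Complex.I * τ * (‖(v : E) + y‖ : ℂ) ^ 2)

/-- The automorphy factor of a theta series in dimension `m`. -/
def thetaFactor (m : ℕ) (τ : ℂ) : ℂ := (Complex.I / τ) ^ (m / 2 : ℂ)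

theorem thetaFactor_pow_eight (m : ℕ) {τ : ℂ} (hτ : τ ≠ 0) :
    thetaFactor m τ ^ 8 * τ ^ (4 * m) = 1 := by
  have h : Complex.I / τ ≠ 0 := div_ne_zero Complex.I_ne_zero hτ
  have h1 : thetaFactor m τ ^ 8 = (Complex.I / τ) ^ (4 * m) := by
    rw [thetaFactor, ← Complex.cpow_nat_mul, ← Complex.cpow_natCast]
    congr 1
    push_cast
    ring
  rw [h1, ← mul_pow, div_mul_cancel₀ _ hτ, pow_mul, Complex.I_pow_four, one_pow]

variable {U : Submodule ℤ E}

theorem cexp_pi_I_mul_add_two_int (z : ℂ) (k : ℤ) :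
    Complex.exp (z + 2 * Real.pi * Complex.I * k) = Complex.exp z := by
  rw [Complex.exp_eq_exp_iff_exists_int]
  exact ⟨k, by ring⟩

theorem norm_add_half_sq (v ξ : E) :
    ‖v + (1 / 2 : ℝ) • ξ‖ ^ 2 = ⟪v, v⟫ + ⟪ξ, v⟫ + ⟪ξ, ξ⟫ / 4 := by
  rw [← real_inner_self_eq_norm_sq, inner_add_add_self, real_inner_smul_right,
    real_inner_smul_left, real_inner_smul_left, real_inner_smul_right, real_inner_comm ξ v]
  ring

theorem IsSelfDual.latticeTheta_zero_add_two (hU : IsSelfDual U) (τ : ℂ) :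
    latticeTheta U 0 (τ + 2) = latticeTheta U 0 τ := by
  refine tsum_congr fun v => ?_
  obtain ⟨k, hk⟩ := hU.inner_int v.2 v.2
  rw [real_inner_self_eq_norm_sq] at hk
  have hk' : (‖(v : E)‖ : ℂ) ^ 2 = k := by exact_mod_cast hk
  rw [← cexp_pi_I_mul_add_two_int (Real.pi * Complex.I * τ * (‖(v : E) + 0‖ : ℂ) ^ 2) k]
  congr 1
  rw [add_zero, hk']
  ring

theorem IsCharVec.latticeTheta_zero_add_one {ξ : E} (hξ : IsCharVec U ξ) (τ : ℂ) :
    latticeTheta U 0 (τ + 1) =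
      ∑' v : U, Complex.exp (Real.pi * Complex.I * τ * (‖(v : E)‖ : ℂ) ^ 2
            + 2 * Real.pi * Complex.I * (⟪(v : E), (1 / 2 : ℝ) • ξ⟫ : ℝ)) := by
  refine tsum_congr fun v => ?_
  obtain ⟨k, hk⟩ := hξ.2 v v.2
  have hk' : ((⟪ξ, (v : E)⟫ : ℝ) : ℂ) = (‖(v : E)‖ : ℂ) ^ 2 + 2 * k := by
    rw [real_inner_self_eq_norm_sq] at hk
    rw [eq_add_of_sub_eq hk]
    push_cast
    ring
  rw [← cexp_pi_I_mul_add_two_int (Real.pi * Complex.I * (τ + 1) * (‖(v : E) + 0‖ : ℂ) ^ 2) k]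
  congr 1
  rw [add_zero, real_inner_smul_right, real_inner_comm]
  push_cast
  rw [hk']
  ring

theorem IsCharVec.latticeTheta_half_add_one {ξ : E} (hξ : IsCharVec U ξ) (hU : IsSelfDual U)
    (τ : ℂ) : latticeTheta U ((1 / 2 : ℝ) • ξ) (τ + 1) =
      Complex.exp (Real.pi * Complex.I * (⟪ξ, ξ⟫ : ℝ) / 4) * latticeTheta U ((1 / 2 : ℝ) • ξ) τ := by
  rw [latticeTheta, latticeTheta, ← tsum_mul_left]
  refine tsum_congr fun v => ?_
  obtain ⟨k, hk⟩ := hξ.2 v v.2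
  obtain ⟨l, hl⟩ := hU.inner_int v.2 v.2
  have h1 : ‖(v : E) + (1 / 2 : ℝ) • ξ‖ ^ 2 = ⟪ξ, ξ⟫ / 4 + 2 * (k + l) := by
    rw [norm_add_half_sq]
    linear_combination hk + 2 * hl
  have h2 : (‖(v : E) + (1 / 2 : ℝ) • ξ‖ : ℂ) ^ 2 = ((⟪ξ, ξ⟫ : ℝ) : ℂ) / 4 + 2 * (k + l : ℤ) := by
    push_cast
    exact_mod_cast h1
  rw [← Complex.exp_add, ← cexp_pi_I_mul_add_two_int (_ + _) (k + l)]
  congr 1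
  linear_combination Real.pi * Complex.I * h2

variable [FiniteDimensional ℝ E]

theorem IsSelfDual.latticeTheta_zero_S (hU : IsSelfDual U) {τ : ℂ} (hτ : 0 < τ.im) :
    latticeTheta U 0 τ = thetaFactor (Module.finrank ℝ E) τ * latticeTheta U 0 (-1 / τ) := by
  rw [latticeTheta, hU.poisson hτ 0]
  simp [latticeTheta, thetaFactor]

theorem IsCharVec.latticeTheta_half_S {ξ : E} (hξ : IsCharVec U ξ) (hU : IsSelfDual U) {τ : ℂ}
    (hτ : 0 < τ.im) : latticeTheta U ((1 / 2 : ℝ) • ξ) τ =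
      thetaFactor (Module.finrank ℝ E) τ * latticeTheta U 0 (-1 / τ + 1) := by
  rw [latticeTheta, hU.poisson hτ, hξ.latticeTheta_zero_add_one]
  rfl

theorem IsSelfDual.summable_exp_neg_add (hU : IsSelfDual U) {a : ℝ} (ha : 0 < a) (y : E) :
    Summable fun v : U => Real.exp (-a * ‖(v : E) + y‖ ^ 2) := by
  refine Summable.of_nonneg_of_le (fun _ => (Real.exp_pos _).le) (fun v => ?_)
    ((hU.summable_exp_neg (half_pos ha)).mul_left (Real.exp (a * ‖y‖ ^ 2)))
  rw [← Real.exp_add, Real.exp_le_exp]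
  have h4 : ‖(v : E)‖ ≤ ‖(v : E) + y‖ + ‖y‖ := by
    simpa using norm_sub_le ((v : E) + y) y
  have h5 : ‖(v : E)‖ ^ 2 ≤ (‖(v : E) + y‖ + ‖y‖) ^ 2 := by gcongr
  nlinarith [sq_nonneg (‖(v : E) + y‖ - ‖y‖)]

theorem IsSelfDual.summable_theta (hU : IsSelfDual U) (y : E) {τ : ℂ} (hτ : 0 < τ.im) :
    Summable fun v : U => Complex.exp (Real.pi * Complex.I * τ * (‖(v : E) + y‖ : ℂ) ^ 2) := by
  refine Summable.of_norm ?_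
  simp only [norm_cexp_gaussian]
  exact hU.summable_exp_neg_add (by positivity) y

theorem cexp_mul_I_mul (t r : ℝ) :
    Complex.exp (Real.pi * Complex.I * (Complex.I * t) * (r : ℂ) ^ 2) =
      (Real.exp (-(Real.pi * t) * r ^ 2) : ℝ) := by
  push_cast
  congr 1
  linear_combination (Real.pi * t * r ^ 2 : ℂ) * Complex.I_sq

omit [InnerProductSpace ℝ E] [FiniteDimensional ℝ E] in
theorem latticeTheta_I_mul (U : Submodule ℤ E) (y : E) (t : ℝ) :
    latticeTheta U y (Complex.I * t) =
      (∑' v : U, Real.exp (-(Real.pi * t) * ‖(v : E) + y‖ ^ 2) : ℝ) := by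
  simp only [latticeTheta, cexp_mul_I_mul, Complex.ofReal_tsum]

theorem IsSelfDual.tsum_exp_pos (hU : IsSelfDual U) (y : E) {t : ℝ} (ht : 0 < t) :
    0 < ∑' v : U, Real.exp (-(Real.pi * t) * ‖(v : E) + y‖ ^ 2) :=
  (hU.summable_exp_neg_add (by positivity) y).tsum_pos (fun _ => (Real.exp_pos _).le) 0
    (Real.exp_pos _)

theorem IsCharVec.exp_norm_eq {ξ : E} (hξ : IsCharVec U ξ) (hU : IsSelfDual U) :
    Complex.exp (Real.pi * Complex.I * (⟪ξ, ξ⟫ : ℝ) / 4) * thetaFactor (Module.finrank ℝ E) Complex.I =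
      thetaFactor (Module.finrank ℝ E) (Complex.I + 1) *
        thetaFactor (Module.finrank ℝ E) (Complex.I / (Complex.I + 1)) := by
  have hI1 : (Complex.I + 1 : ℂ) ≠ 0 := by
    intro h; simpa using congrArg Complex.re h
  have hpos : latticeTheta U ((1 / 2 : ℝ) • ξ) Complex.I ≠ 0 := by
    have := latticeTheta_I_mul U ((1 / 2 : ℝ) • ξ) 1
    rw [Complex.ofReal_one, mul_one] at this
    rw [this, Complex.ofReal_ne_zero]
    exact (hU.tsum_exp_pos _ one_pos).ne'
  have hS1 := hξ.latticeTheta_half_S hU (τ := Complex.I) (by simp)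
  have hS2 := hξ.latticeTheta_half_S hU (τ := Complex.I + 1) (by simp)
  have h3 : (-1 / (Complex.I + 1) + 1 : ℂ) = Complex.I / (Complex.I + 1) := by
    field_simp; ring
  have him : 0 < (Complex.I / (Complex.I + 1)).im := by
    rw [← h3, Complex.add_im, Complex.one_im, add_zero]
    exact neg_inv_im_pos (by simp)
  have hS3 := hU.latticeTheta_zero_S him
  have h4 : (-1 / (Complex.I / (Complex.I + 1)) : ℂ) + 2 = -1 / Complex.I + 1 := by
    field_simp; ring
  rw [← hU.latticeTheta_zero_add_two (-1 / (Complex.I / (Complex.I + 1))), h4] at hS3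
  rw [h3, hS3, hξ.latticeTheta_half_add_one hU] at hS2
  set x := latticeTheta U 0 (-1 / Complex.I + 1)
  rw [hS1] at hS2 hpos
  have hx : x ≠ 0 := right_ne_zero_of_mul hpos
  refine mul_right_cancel₀ hx ?_
  linear_combination hS2

theorem latticeTheta_differentiableAt (hU : IsSelfDual U) (y : E) {τ : ℂ} (hτ : 0 < τ.im) :
    DifferentiableAt ℂ (latticeTheta U y) τ := by
  have hopen : IsOpen {z : ℂ | τ.im / 2 < z.im} := isOpen_lt continuous_const Complex.continuous_im
  have : DifferentiableOn ℂ (latticeTheta U y) {z : ℂ | τ.im / 2 < z.im} := by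
    refine Complex.differentiableOn_tsum_of_summable_norm
      (hU.summable_exp_neg_add (a := Real.pi * (τ.im / 2)) (by positivity) y)
      (fun v => by fun_prop) hopen fun v z hz => ?_
    rw [norm_cexp_gaussian, Real.exp_le_exp]
    have hz' : τ.im / 2 < z.im := hz
    have : Real.pi * (τ.im / 2) ≤ Real.pi * z.im := by gcongr
    nlinarith [sq_nonneg ‖(v : E) + y‖]
  exact this.differentiableAt (hopen.mem_nhds (by simpa using hτ))

theorem norm_tsum_gaussian_le {X : Type*} {q : X → ℝ} (hq : Summable fun x => Real.exp (-Real.pi * q x ^ 2))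
    {M : ℝ} (hM : ∀ x, M ≤ q x ^ 2) :
    ∃ C : ℝ, ∀ τ : ℂ, 1 ≤ τ.im →
      ‖∑' x, Complex.exp (Real.pi * Complex.I * τ * (q x : ℂ) ^ 2)‖ ≤
        C * Real.exp (-(Real.pi * M) * τ.im) := by
  refine ⟨(∑' x, Real.exp (-Real.pi * q x ^ 2)) * Real.exp (Real.pi * M), fun τ hτ => ?_⟩
  rw [mul_assoc (tsum _), ← Real.exp_add]
  refine tsum_of_norm_bounded (hq.hasSum.mul_right _) fun x => ?_
  rw [norm_cexp_gaussian, ← Real.exp_add, Real.exp_le_exp]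
  have h1 := mul_nonneg (mul_nonneg Real.pi_pos.le (sub_nonneg.2 (hM x))) (sub_nonneg.2 hτ)
  linarith

theorem IsSelfDual.norm_latticeTheta_sub_one_le (hU : IsSelfDual U) :
    ∃ C : ℝ, ∀ τ : ℂ, 1 ≤ τ.im →
      ‖latticeTheta U 0 τ - 1‖ ≤ C * Real.exp (-Real.pi * τ.im) := by
  have hs : Summable fun x : {v : U // v ≠ 0} => Real.exp (-Real.pi * ‖((x : U) : E)‖ ^ 2) :=
    (hU.summable_exp_neg Real.pi_pos).comp_injective Subtype.val_injective
  obtain ⟨C, hC⟩ := norm_tsum_gaussian_le (M := 1) hs (fun x => by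
    have := hU.one_le_norm x.1.2 (fun h => x.2 (Subtype.ext h))
    nlinarith)
  refine ⟨C, fun τ hτ => ?_⟩
  have h := hC τ hτ
  rw [mul_one] at h
  convert h using 2
  have hsum := hU.summable_theta 0 (τ := τ) (by linarith)
  have h0 := hsum.tsum_subtype_add_tsum_subtype_compl {0}
  rw [tsum_singleton (0 : U)
    (fun v : U => Complex.exp (Real.pi * Complex.I * τ * (‖(v : E) + 0‖ : ℂ) ^ 2))] at h0
  rw [latticeTheta, ← h0]
  simp only [ZeroMemClass.coe_zero, add_zero, norm_zero, Complex.ofReal_zero, ne_eq,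
    OfNat.ofNat_ne_zero, not_false_eq_true, zero_pow, mul_zero, Complex.exp_zero,
    add_sub_cancel_left]
  rfl

end Theta

section LevelOne
open scoped Manifold
open UpperHalfPlane ModularForm SlashInvariantForm OnePoint MatrixGroups

theorem discriminant_T_smul (z : ℍ) : discriminant (ModularGroup.T • z) = discriminant z := by
  have h := congrFun discriminant_T_invariant z
  rw [SL_slash_apply] at h
  rw [ModularGroup.denom_apply] at h
  norm_num [ModularGroup.T] at h
  exact h

theorem discriminant_S_smul (z : ℍ) :
    discriminant (ModularGroup.S • z) = (z : ℂ) ^ 12 * discriminant z := by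
  have h := congrFun discriminant_S_invariant z
  rw [SL_slash_apply] at h
  have hz : (z : ℂ) ≠ 0 := z.ne_zero
  rw [← h, ModularGroup.denom_S, zpow_neg]
  field_simp

/-- A weakly modular function for the full modular group of weight `12 m` that decays faster
than `Δ ^ m` at the cusp vanishes identically. -/
theorem eq_zero_of_levelOne_of_decay {N : ℂ → ℂ} (m : ℕ)
    (hd : DifferentiableOn ℂ N {z | 0 < z.im}) (hT : ∀ z : ℂ, 0 < z.im → N (z + 1) = N z)
    (hS : ∀ z : ℂ, 0 < z.im → N (-1 / z) = z ^ (12 * m) * N z)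
    {C c : ℝ} (hc : 0 < c) (hN : ∀ z : ℂ, 1 ≤ z.im →
      ‖N z‖ ≤ C * Real.exp (-(2 * Real.pi * m + c) * z.im)) :
    ∀ z : ℂ, 0 < z.im → N z = 0 := by
  let H : ℍ → ℂ := fun z => N z / discriminant z ^ m
  have hHT : H ∣[(0 : ℤ)] ModularGroup.T = H := by
    ext z
    rw [SL_slash_apply, neg_zero, zpow_zero, mul_one]
    simp only [H]
    rw [discriminant_T_smul, modular_T_smul]
    congr 1
    rw [← hT z z.2]
    congr 1
    simp [add_comm]
  have hHS : H ∣[(0 : ℤ)] ModularGroup.S = H := by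
    ext z
    rw [SL_slash_apply, neg_zero, zpow_zero, mul_one]
    simp only [H]
    rw [discriminant_S_smul, modular_S_smul]
    have h1 : N ((-(z : ℂ))⁻¹) = (z : ℂ) ^ (12 * m) * N z := by
      rw [← hS z z.2]
      congr 1
      rw [inv_neg, neg_div, one_div]
    have hz : (z : ℂ) ≠ 0 := z.ne_zero
    change N ((-(z : ℂ))⁻¹) / _ = _
    rw [h1, mul_pow, ← pow_mul, mul_div_mul_left _ _ (pow_ne_zero _ hz)]
  have hinv := slash_action_generators_SL2Z hHS hHT
  have hO : (fun z : ℍ => N z) =O[atImInfty] fun z : ℍ => Real.exp (-(2 * Real.pi * m + c) * z.im) := by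
    refine Asymptotics.IsBigO.of_bound C ?_
    filter_upwards [atImInfty_mem _ |>.2 ⟨1, fun z hz => hz⟩] with z hz
    rw [Real.norm_of_nonneg (Real.exp_pos _).le]
    exact hN z hz
  have hto : Filter.Tendsto H atImInfty (nhds 0) := by
    have h1 : (fun z : ℍ => Real.exp (-(2 * Real.pi * m + c) * z.im)) =
        fun z : ℍ => Real.exp (-c * z.im) * Real.exp (-2 * Real.pi * z.im) ^ m := by
      ext z
      rw [← Real.exp_nat_mul, ← Real.exp_add]
      congr 1
      ring
    have h2 : (fun z : ℍ => N z) =O[atImInfty]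
        fun z : ℍ => (Real.exp (-c * z.im) : ℂ) * discriminant z ^ m := by
      refine hO.trans ?_
      rw [h1]
      refine Asymptotics.IsBigO.mul ?_ (exp_isBigO_discriminant.pow m)
      refine Asymptotics.IsBigO.of_bound 1 (Filter.Eventually.of_forall fun z => ?_)
      rw [one_mul, Complex.norm_real]
    have h3 : H =O[atImInfty] fun z : ℍ => (Real.exp (-c * z.im) : ℂ) := by
      refine (h2.mul (Asymptotics.isBigO_refl (fun z => (discriminant z ^ m)⁻¹) _)).congr' ?_ ?_
      · exact Filter.Eventually.of_forall fun z => (div_eq_mul_inv _ _).symm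
      · exact Filter.Eventually.of_forall fun z =>
          mul_inv_cancel_right₀ (pow_ne_zero _ (discriminant_ne_zero z)) _
    refine h3.trans_tendsto ?_
    have h4 : Filter.Tendsto (fun z : ℍ => Real.exp (-c * z.im)) atImInfty (nhds 0) := by
      refine Real.tendsto_exp_atBot.comp ?_
      exact Filter.Tendsto.const_mul_atTop_of_neg (by linarith) Filter.tendsto_comap
    exact_mod_cast (Complex.continuous_ofReal.tendsto 0).comp h4
  let F : ModularForm 𝒮ℒ 0 :=
    { toFun := H
      slash_action_eq' := fun _ ⟨γ, hγ⟩ => hγ ▸ hinv γ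
      holo' := by
        have hN' : MDiff (fun z : ℍ => N z) := by
          rw [UpperHalfPlane.mdifferentiable_iff]
          refine hd.congr fun z hz => ?_
          simp [ofComplex_apply_of_im_pos hz]
        exact hN'.div (CuspForm.discriminant.holo'.pow m)
          fun z => pow_ne_zero _ (discriminant_ne_zero z)
      bdd_at_cusps' := fun {c} hc => by
        rw [Subgroup.IsArithmetic.isCusp_iff_isCusp_SL2Z] at hc
        rw [isBoundedAt_iff_forall_SL2Z hc]
        intro γ _
        rw [hinv γ, IsBoundedAtImInfty, Filter.BoundedAtFilter]
        exact hto.isBigO_one ℝ }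
  obtain ⟨d, hd⟩ := ModularFormClass.levelOne_weight_zero_const F
  have hH : H = Function.const ℍ d := hd
  have hd0 : d = 0 := by
    rw [hH] at hto
    exact tendsto_nhds_unique tendsto_const_nhds hto
  intro z hz
  have h := congrFun hH ⟨z, hz⟩
  rw [hd0] at h
  exact (div_eq_zero_iff.1 h).resolve_right (pow_ne_zero _ (discriminant_ne_zero _))

end LevelOne

section Cubic
variable {E : Type*} [NormedAddCommGroup E] [InnerProductSpace ℝ E] {ι : Type*} [Fintype ι]

/-- The `ℤ`-span of an orthonormal basis. -/
def cubicLattice (b : OrthonormalBasis ι ℝ E) : Submodule ℤ E where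
  carrier := {x | ∀ i, ∃ k : ℤ, ⟪b i, x⟫ = k}
  zero_mem' i := ⟨0, by simp⟩
  add_mem' {x y} hx hy i := by
    obtain ⟨k, hk⟩ := hx i
    obtain ⟨l, hl⟩ := hy i
    exact ⟨k + l, by rw [inner_add_right, hk, hl]; push_cast; rfl⟩
  smul_mem' c x hx i := by
    obtain ⟨k, hk⟩ := hx i
    refine ⟨c * k, ?_⟩
    rw [← Int.cast_smul_eq_zsmul ℝ, real_inner_smul_right, hk]
    push_cast; rfl

variable (b : OrthonormalBasis ι ℝ E)

theorem self_mem_cubicLattice (i : ι) : b i ∈ cubicLattice b := by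
  classical
  intro j
  refine ⟨if j = i then 1 else 0, ?_⟩
  rw [orthonormal_iff_ite.1 b.orthonormal]
  split_ifs <;> simp

theorem isSelfDual_cubicLattice : IsSelfDual (cubicLattice b) where
  span_top := by
    rw [eq_top_iff, ← b.toBasis.span_eq, Submodule.span_le]
    rintro _ ⟨i, rfl⟩
    refine Submodule.subset_span ?_
    simpa using self_mem_cubicLattice b i
  mem_iff x := by
    constructor
    · intro hx v hv
      choose k hk using hx
      choose l hl using hv
      refine ⟨∑ i, k i * l i, ?_⟩
      rw [← b.sum_inner_mul_inner x v]
      push_cast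
      refine Finset.sum_congr rfl fun i _ => ?_
      rw [real_inner_comm, hk, hl]
    · intro h i
      obtain ⟨k, hk⟩ := h _ (self_mem_cubicLattice b i)
      exact ⟨k, by rw [real_inner_comm, hk]⟩

theorem isCharVec_cubicLattice : IsCharVec (cubicLattice b) (∑ i, b i) := by
  refine ⟨Submodule.sum_mem _ fun i _ => self_mem_cubicLattice b i, fun v hv => ?_⟩
  choose k hk using hv
  have h : ∀ i, ∃ l : ℤ, k i - k i * k i = 2 * l := fun i => by
    obtain ⟨l, hl⟩ := Int.even_mul_succ_self (k i - 1)
    exact ⟨-l, by linear_combination -hl⟩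
  choose l hl using h
  refine ⟨∑ i, l i, ?_⟩
  rw [← b.sum_inner_mul_inner v v, sum_inner, ← Finset.sum_sub_distrib]
  push_cast
  rw [Finset.mul_sum]
  refine Finset.sum_congr rfl fun i _ => ?_
  rw [real_inner_comm (b i) v, hk]
  exact_mod_cast hl i

theorem inner_sum_self : ⟪∑ i, b i, ∑ i, b i⟫ = Fintype.card ι := by
  classical
  simp only [sum_inner, inner_sum, orthonormal_iff_ite.1 b.orthonormal]
  simp

theorem IsCharVec.card_le_of_cubicLattice {ξ : E} (hξ : IsCharVec (cubicLattice b) ξ) :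
    (Fintype.card ι : ℝ) ≤ ⟪ξ, ξ⟫ := by
  rw [← b.sum_inner_mul_inner ξ ξ, ← nsmul_one, ← Finset.card_univ, ← Finset.sum_const]
  refine Finset.sum_le_sum fun i _ => ?_
  obtain ⟨k, hk⟩ := hξ.2 _ (self_mem_cubicLattice b i)
  rw [real_inner_self_eq_norm_sq, b.orthonormal.1 i] at hk
  rw [real_inner_comm ξ (b i)]
  have h : ⟪ξ, b i⟫ = ((2 * k + 1 : ℤ) : ℝ) := by push_cast; linarith
  rw [h]
  have h0 : (2 * k + 1 : ℤ) ≠ 0 := by omega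
  have : 1 ≤ (2 * k + 1) * (2 * k + 1) := by
    have := Int.one_le_abs h0
    nlinarith [abs_mul_abs_self (2 * k + 1)]
  exact_mod_cast this

end Cubic

section VanDerBlij
variable {E : Type*} [NormedAddCommGroup E] [InnerProductSpace ℝ E] [FiniteDimensional ℝ E]
  {U : Submodule ℤ E}

/-- van der Blij's lemma: the square of a characteristic vector of a unimodular lattice is
congruent to the rank modulo `8`. -/
theorem IsCharVec.norm_modEq {ξ : E} (hξ : IsCharVec U ξ) (hU : IsSelfDual U) :
    ∃ k : ℤ, ⟪ξ, ξ⟫ = Module.finrank ℝ E + 8 * k := by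
  let b := stdOrthonormalBasis ℝ E
  have h1 := hξ.exp_norm_eq hU
  rw [← (isCharVec_cubicLattice b).exp_norm_eq (isSelfDual_cubicLattice b), inner_sum_self,
    Fintype.card_fin] at h1
  have h0 : thetaFactor (Module.finrank ℝ E) Complex.I ≠ 0 := by
    simp [thetaFactor]
  have h2 := mul_right_cancel₀ h0 h1
  obtain ⟨k, hk⟩ := Complex.exp_eq_exp_iff_exists_int.1 h2
  refine ⟨k, ?_⟩
  have hpi : (Real.pi * Complex.I : ℂ) ≠ 0 := by simp [Real.pi_ne_zero]
  have h3 : ((⟪ξ, ξ⟫ : ℝ) : ℂ) = ((Module.finrank ℝ E + 8 * k : ℝ) : ℂ) := by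
    refine mul_left_cancel₀ hpi ?_
    push_cast at hk ⊢
    linear_combination 4 * hk
  exact_mod_cast h3

end VanDerBlij

section Elkies

/-- A function which is modular for the theta group vanishes if the product of its conjugates
under the full modular group decays fast enough at the cusp. -/
theorem eq_zero_of_thetaGroup_of_decay {A B C : ℂ → ℂ} (m : ℕ)
    (hA : DifferentiableOn ℂ A {z | 0 < z.im}) (hB : DifferentiableOn ℂ B {z | 0 < z.im})
    (hC : DifferentiableOn ℂ C {z | 0 < z.im})
    (hAT : ∀ z : ℂ, 0 < z.im → A (z + 1) = B z) (hBT : ∀ z : ℂ, 0 < z.im → B (z + 1) = A z)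
    (hCT : ∀ z : ℂ, 0 < z.im → C (z + 1) = C z)
    (hAS : ∀ z : ℂ, 0 < z.im → A (-1 / z) = z ^ (4 * m) * A z)
    (hBS : ∀ z : ℂ, 0 < z.im → B (-1 / z) = z ^ (4 * m) * C z)
    (hCS : ∀ z : ℂ, 0 < z.im → C (-1 / z) = z ^ (4 * m) * B z)
    {a b c : ℝ}
    (ha : ∀ z : ℂ, 1 ≤ z.im → ‖A z‖ ≤ a * Real.exp (-Real.pi * z.im))
    (hb : ∀ z : ℂ, 1 ≤ z.im → ‖B z‖ ≤ b * Real.exp (-Real.pi * z.im))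
    (hc : ∀ z : ℂ, 1 ≤ z.im → ‖C z‖ ≤ c * Real.exp (-(2 * Real.pi * m) * z.im)) :
    ∀ z : ℂ, 0 < z.im → A z = 0 := by
  have hN : ∀ z : ℂ, 0 < z.im → A z * (B z * C z) = 0 := by
    refine eq_zero_of_levelOne_of_decay m (hA.mul (hB.mul hC)) (fun z hz => ?_) (fun z hz => ?_)
      (C := a * (b * c)) (c := 2 * Real.pi) (by positivity) (fun z hz => ?_)
    · simp only [hAT z hz, hBT z hz, hCT z hz]; ring
    · simp only [hAS z hz, hBS z hz, hCS z hz]; ring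
    · have h : Real.exp (-(2 * Real.pi * m + 2 * Real.pi) * z.im) =
          Real.exp (-Real.pi * z.im) * (Real.exp (-Real.pi * z.im) *
            Real.exp (-(2 * Real.pi * m) * z.im)) := by
        rw [← Real.exp_add, ← Real.exp_add]; congr 1; ring
      have hb' := (norm_nonneg _).trans (hb z hz)
      have ha' := (norm_nonneg _).trans (ha z hz)
      calc ‖A z * (B z * C z)‖ = ‖A z‖ * (‖B z‖ * ‖C z‖) := by rw [norm_mul, norm_mul]
        _ ≤ (a * Real.exp (-Real.pi * z.im)) * ((b * Real.exp (-Real.pi * z.im)) *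
            (c * Real.exp (-(2 * Real.pi * m) * z.im))) := by
          gcongr
          · exact ha z hz
          · exact hb z hz
          · exact hc z hz
        _ = _ := by rw [h]; ring
  have hopen : IsOpen {z : ℂ | 0 < z.im} := isOpen_lt continuous_const Complex.continuous_im
  have hconn : IsPreconnected {z : ℂ | 0 < z.im} := (convex_halfSpace_im_gt 0).isPreconnected
  have hBA : (∀ z : ℂ, 0 < z.im → B z = 0) → ∀ z : ℂ, 0 < z.im → A z = 0 := fun h z hz => by
    rw [← hBT z hz]; exact h _ (by simpa using hz)
  have hCB : (∀ z : ℂ, 0 < z.im → C z = 0) → ∀ z : ℂ, 0 < z.im → B z = 0 := fun h z hz => by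
    have h0 : z ≠ 0 := by rintro rfl; simp at hz
    have h1 := hCS z hz
    rw [h _ (neg_inv_im_pos hz)] at h1
    exact (mul_eq_zero.1 h1.symm).resolve_left (pow_ne_zero _ h0)
  rcases (hA.analyticOnNhd hopen).eq_zero_or_eq_zero_of_mul_eq_zero
    ((hB.mul hC).analyticOnNhd hopen) hN hconn with h | h
  · exact h
  rcases (hB.analyticOnNhd hopen).eq_zero_or_eq_zero_of_mul_eq_zero
    (hC.analyticOnNhd hopen) h hconn with h | h
  · exact hBA h
  · exact hBA (hCB h)

theorem norm_pow_eight_sub_pow_eight_le {x y : ℂ} {K : ℝ} (hx : ‖x‖ ≤ K) (hy : ‖y‖ ≤ K) :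
    ‖x ^ 8 - y ^ 8‖ ≤ (2 * K) * (2 * K ^ 2) * (2 * K ^ 4) * ‖x - y‖ := by
  have h : ∀ n : ℕ, ‖x ^ n + y ^ n‖ ≤ 2 * K ^ n := fun n => by
    have h1 : ‖x‖ ^ n ≤ K ^ n := by gcongr
    have h2 : ‖y‖ ^ n ≤ K ^ n := by gcongr
    calc ‖x ^ n + y ^ n‖ ≤ ‖x‖ ^ n + ‖y‖ ^ n := by
          rw [← norm_pow, ← norm_pow]; exact norm_add_le _ _
      _ ≤ _ := by linarith
  have hK : 0 ≤ K := (norm_nonneg _).trans hx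
  rw [show x ^ 8 - y ^ 8 = (x ^ 1 + y ^ 1) * (x ^ 2 + y ^ 2) * (x ^ 4 + y ^ 4) * (x - y) by ring,
    norm_mul, norm_mul, norm_mul]
  gcongr
  · simpa using h 1
  · exact h 2
  · exact h 4

variable {E : Type*} [NormedAddCommGroup E] [InnerProductSpace ℝ E] [FiniteDimensional ℝ E]
  {U Z : Submodule ℤ E}

theorem IsSelfDual.norm_latticeTheta_pow_sub_le (hU : IsSelfDual U) (hZ : IsSelfDual Z) :
    ∃ a : ℝ, ∀ τ : ℂ, 1 ≤ τ.im →
      ‖latticeTheta U 0 τ ^ 8 - latticeTheta Z 0 τ ^ 8‖ ≤ a * Real.exp (-Real.pi * τ.im) := by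
  obtain ⟨C, hC⟩ := hU.norm_latticeTheta_sub_one_le
  obtain ⟨D, hD⟩ := hZ.norm_latticeTheta_sub_one_le
  have key : ∀ (x : ℂ) (C D t : ℝ), 0 ≤ t → ‖x - 1‖ ≤ C * Real.exp (-Real.pi * t) →
      ‖x‖ ≤ 1 + |C| + |D| := fun x C D t ht h => by
    have h1 : Real.exp (-Real.pi * t) ≤ 1 := by
      rw [Real.exp_le_one_iff]; nlinarith [Real.pi_pos]
    have h2 : C * Real.exp (-Real.pi * t) ≤ |C| * 1 :=
      mul_le_mul (le_abs_self C) h1 (Real.exp_pos _).le (abs_nonneg C)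
    have h3 : ‖x‖ ≤ ‖x - 1‖ + 1 := by simpa using norm_add_le (x - 1) 1
    linarith [abs_nonneg D]
  set K := 1 + |C| + |D| with hK
  refine ⟨(2 * K) * (2 * K ^ 2) * (2 * K ^ 4) * (C + D), fun τ hτ => ?_⟩
  refine (norm_pow_eight_sub_pow_eight_le (key _ C D τ.im (by linarith) (hC τ hτ))
    (K := K) ?_).trans ?_
  · have := key _ D C τ.im (by linarith) (hD τ hτ)
    linarith
  · rw [mul_assoc _ (C + D)]
    gcongr
    calc ‖latticeTheta U 0 τ - latticeTheta Z 0 τ‖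
        = ‖(latticeTheta U 0 τ - 1) - (latticeTheta Z 0 τ - 1)‖ := by congr 1; ring
      _ ≤ _ := norm_sub_le _ _
      _ ≤ _ := add_le_add (hC τ hτ) (hD τ hτ)
      _ = _ := by ring

omit [FiniteDimensional ℝ E] in
theorem IsCharVec.add_two_smul {ξ v : E} (hξ : IsCharVec U ξ) (hU : IsSelfDual U) (hv : v ∈ U) :
    IsCharVec U ((2 : ℝ) • v + ξ) := by
  refine ⟨?_, fun u hu => ?_⟩
  · rw [two_smul]
    exact U.add_mem (U.add_mem hv hv) hξ.1
  · obtain ⟨k, hk⟩ := hξ.2 u hu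
    obtain ⟨l, hl⟩ := hU.inner_int hv hu
    refine ⟨k + l, ?_⟩
    rw [inner_add_left, real_inner_smul_left, hl]
    push_cast
    linear_combination hk

theorem IsCharVec.norm_latticeTheta_half_pow_le {ξ : E} (hξ : IsCharVec U ξ) (hU : IsSelfDual U)
    {m : ℕ} (hm : ∀ χ, IsCharVec U χ → (m : ℝ) ≤ ⟪χ, χ⟫) :
    ∃ c : ℝ, ∀ τ : ℂ, 1 ≤ τ.im →
      ‖latticeTheta U ((1 / 2 : ℝ) • ξ) τ ^ 8‖ ≤ c * Real.exp (-(2 * Real.pi * m) * τ.im) := by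
  obtain ⟨C, hC⟩ := norm_tsum_gaussian_le (X := U) (q := fun v => ‖(v : E) + (1 / 2 : ℝ) • ξ‖)
    (M := m / 4) (hU.summable_exp_neg_add Real.pi_pos _) (fun v => by
      have h := hm _ (hξ.add_two_smul hU v.2)
      rw [inner_add_add_self, real_inner_smul_right, real_inner_smul_left, real_inner_smul_left,
        real_inner_smul_right, real_inner_comm ξ] at h
      rw [norm_add_half_sq]
      linarith)
  refine ⟨C ^ 8, fun τ hτ => ?_⟩
  have h : Real.exp (-(2 * Real.pi * m) * τ.im) = Real.exp (-(Real.pi * (m / 4)) * τ.im) ^ 8 := by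
    rw [← Real.exp_nat_mul]; congr 1; push_cast; ring
  rw [h, ← mul_pow, norm_pow]
  exact pow_le_pow_left₀ (norm_nonneg _) (hC τ hτ) 8

omit [FiniteDimensional ℝ E] in
theorem IsCharVec.latticeTheta_half_pow_add_one {ξ : E} (hξ : IsCharVec U ξ) (hU : IsSelfDual U)
    (τ : ℂ) : latticeTheta U ((1 / 2 : ℝ) • ξ) (τ + 1) ^ 8 =
      latticeTheta U ((1 / 2 : ℝ) • ξ) τ ^ 8 := by
  obtain ⟨k, hk⟩ := hU.inner_int hξ.1 hξ.1
  rw [hξ.latticeTheta_half_add_one hU, mul_pow, ← Complex.exp_nat_mul, hk]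
  rw [show ((8 : ℕ) : ℂ) * (Real.pi * Complex.I * ((k : ℝ) : ℂ) / 4) =
    0 + 2 * Real.pi * Complex.I * k by push_cast; ring, cexp_pi_I_mul_add_two_int,
    Complex.exp_zero, one_mul]

theorem IsSelfDual.latticeTheta_pow_eq {ξ ζ : E} (hU : IsSelfDual U) (hZ : IsSelfDual Z)
    (hξ : IsCharVec U ξ) (hζ : IsCharVec Z ζ)
    (hUm : ∀ χ, IsCharVec U χ → (Module.finrank ℝ E : ℝ) ≤ ⟪χ, χ⟫)
    (hZm : ∀ χ, IsCharVec Z χ → (Module.finrank ℝ E : ℝ) ≤ ⟪χ, χ⟫) :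
    ∀ τ : ℂ, 0 < τ.im → latticeTheta U 0 τ ^ 8 - latticeTheta Z 0 τ ^ 8 = 0 := by
  set m := Module.finrank ℝ E with hm
  obtain ⟨a, ha⟩ := hU.norm_latticeTheta_pow_sub_le hZ
  obtain ⟨c, hc⟩ := hξ.norm_latticeTheta_half_pow_le hU hUm
  obtain ⟨d, hd⟩ := hζ.norm_latticeTheta_half_pow_le hZ hZm
  have hne : ∀ {z : ℂ}, 0 < z.im → z ≠ 0 := by rintro z hz rfl; simp at hz
  have hS : ∀ z : ℂ, 0 < z.im → ∀ x y x' y' : ℂ, x = thetaFactor m z * x' →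
      y = thetaFactor m z * y' → x' ^ 8 - y' ^ 8 = z ^ (4 * m) * (x ^ 8 - y ^ 8) := by
    rintro z hz _ _ x' y' rfl rfl
    have := thetaFactor_pow_eight m (hne hz)
    linear_combination (y' ^ 8 - x' ^ 8) * this
  have hcs : ∀ z : ℂ, 0 < z.im → latticeTheta U 0 (-1 / z + 1) ^ 8 -
      latticeTheta Z 0 (-1 / z + 1) ^ 8 = z ^ (4 * m) *
        (latticeTheta U ((1 / 2 : ℝ) • ξ) z ^ 8 - latticeTheta Z ((1 / 2 : ℝ) • ζ) z ^ 8) :=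
    fun z hz => hS z hz _ _ _ _ (hξ.latticeTheta_half_S hU hz) (hζ.latticeTheta_half_S hZ hz)
  have hdiff : ∀ {V : Submodule ℤ E}, IsSelfDual V → ∀ y z, 0 < z.im →
      DifferentiableAt ℂ (fun z => latticeTheta V y z ^ 8) z := fun hV y z hz =>
    (latticeTheta_differentiableAt hV y hz).pow 8
  refine eq_zero_of_thetaGroup_of_decay m
    (A := fun τ => latticeTheta U 0 τ ^ 8 - latticeTheta Z 0 τ ^ 8)
    (B := fun τ => latticeTheta U 0 (τ + 1) ^ 8 - latticeTheta Z 0 (τ + 1) ^ 8)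
    (C := fun τ => latticeTheta U ((1 / 2 : ℝ) • ξ) τ ^ 8 - latticeTheta Z ((1 / 2 : ℝ) • ζ) τ ^ 8)
    ?_ ?_ ?_ (fun z _ => rfl) (fun z _ => ?_) (fun z _ => ?_) (fun z hz => ?_) hcs
    (fun z hz => ?_) ha (b := a) (fun z hz => ?_) (c := c + d) (fun z hz => ?_)
  · exact fun z hz => ((hdiff hU _ z hz).sub (hdiff hZ _ z hz)).differentiableWithinAt
  · intro z hz
    have hz1 : 0 < (z + 1).im := by simpa using hz
    have h1 : ∀ {V : Submodule ℤ E}, IsSelfDual V →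
        DifferentiableAt ℂ (fun z => latticeTheta V 0 (z + 1) ^ 8) z := fun hV =>
      DifferentiableAt.comp (f := fun z : ℂ => z + 1) z (hdiff hV 0 _ hz1) (by fun_prop)
    exact ((h1 hU).sub (h1 hZ)).differentiableWithinAt
  · exact fun z hz => ((hdiff hU _ z hz).sub (hdiff hZ _ z hz)).differentiableWithinAt
  · rw [add_assoc, one_add_one_eq_two, hU.latticeTheta_zero_add_two, hZ.latticeTheta_zero_add_two]
  · simp only [hξ.latticeTheta_half_pow_add_one hU, hζ.latticeTheta_half_pow_add_one hZ]
  · exact hS z hz _ _ _ _ (hU.latticeTheta_zero_S hz) (hZ.latticeTheta_zero_S hz)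
  · have h := hcs _ (neg_inv_im_pos hz)
    have h1 : -1 / (-1 / z) = z := by
      have := hne hz
      field_simp
    have h2 : (-1 / z) ^ (4 * m) * z ^ (4 * m) = 1 := by
      rw [← mul_pow, div_mul_cancel₀ _ (hne hz), pow_mul]; norm_num
    rw [h1] at h
    rw [h]
    linear_combination (-1 : ℂ) * (latticeTheta U ((1 / 2 : ℝ) • ξ) (-1 / z) ^ 8 -
      latticeTheta Z ((1 / 2 : ℝ) • ζ) (-1 / z) ^ 8) * h2
  · have := ha (z + 1) (by simpa using hz)
    simpa using this
  · refine (norm_sub_le _ _).trans ?_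
    rw [add_mul]
    exact add_le_add (hc z hz) (hd z hz)

end Elkies

section Kissing
open Filter Topology
variable {E : Type*} [NormedAddCommGroup E] [InnerProductSpace ℝ E] [FiniteDimensional ℝ E]
  {U Z : Submodule ℤ E}

/-- The number of vectors of norm one in a lattice, as a sum. -/
def kissingSum (U : Submodule ℤ E) : ℝ :=
  ∑' v : U, {v : U | ‖(v : E)‖ = 1}.indicator 1 v

theorem tendsto_exp_mul_atTop {r : ℝ} (h0 : 1 ≤ r) :
    Tendsto (fun t : ℝ => Real.exp (Real.pi * t) * Real.exp (-(Real.pi * t) * r ^ 2)) atTop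
      (𝓝 ({r : ℝ | r = 1}.indicator 1 r)) := by
  have h : ∀ t : ℝ, Real.exp (Real.pi * t) * Real.exp (-(Real.pi * t) * r ^ 2) =
      Real.exp (Real.pi * (1 - r ^ 2) * t) := fun t => by
    rw [← Real.exp_add]; congr 1; ring
  simp only [h]
  rcases h0.eq_or_lt with rfl | h1
  · simp
  · rw [Set.indicator_of_notMem (show r ∉ {r : ℝ | r = 1} from h1.ne')]
    refine Real.tendsto_exp_atBot.comp (tendsto_id.const_mul_atTop_of_neg ?_)
    have : 1 < r ^ 2 := by nlinarith
    nlinarith [Real.pi_pos]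

theorem IsSelfDual.tendsto_kissingSum (hU : IsSelfDual U) :
    Tendsto (fun t : ℝ => Real.exp (Real.pi * t) *
      ((∑' v : U, Real.exp (-(Real.pi * t) * ‖(v : E) + 0‖ ^ 2)) - 1)) atTop
      (𝓝 (kissingSum U)) := by
  classical
  have h1 : ∀ t : ℝ, 0 < t → Real.exp (Real.pi * t) *
      ((∑' v : U, Real.exp (-(Real.pi * t) * ‖(v : E) + 0‖ ^ 2)) - 1) =
      ∑' v : U, if v = 0 then 0 else
        Real.exp (Real.pi * t) * Real.exp (-(Real.pi * t) * ‖(v : E)‖ ^ 2) := fun t ht => by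
    have hs := hU.summable_exp_neg (a := Real.pi * t) (by positivity)
    simp only [add_zero]
    rw [hs.tsum_eq_add_tsum_ite 0]
    simp only [ZeroMemClass.coe_zero, norm_zero, ne_eq, OfNat.ofNat_ne_zero, not_false_eq_true,
      zero_pow, mul_zero, Real.exp_zero, add_sub_cancel_left]
    rw [← tsum_mul_left]
    refine tsum_congr fun v => ?_
    split_ifs <;> simp
  refine Tendsto.congr' ((eventually_gt_atTop 0).mono fun t ht => (h1 t ht).symm) ?_
  refine tendsto_tsum_of_dominated_convergence
    (bound := fun v : U => Real.exp Real.pi * Real.exp (-Real.pi * ‖(v : E)‖ ^ 2))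
    ((hU.summable_exp_neg Real.pi_pos).mul_left _) (fun v => ?_)
    ((eventually_ge_atTop 1).mono fun t ht v => ?_)
  · by_cases hv : v = 0
    · simp [hv]
    · simp only [if_neg hv]
      exact tendsto_exp_mul_atTop (hU.one_le_norm v.2 fun h => hv (Subtype.ext h))
  · by_cases hv : v = 0
    · simp only [if_pos hv, norm_zero]; positivity
    · have := hU.one_le_norm v.2 fun h => hv (Subtype.ext h)
      rw [if_neg hv, ← Real.exp_add, ← Real.exp_add, Real.norm_of_nonneg (Real.exp_pos _).le,
        Real.exp_le_exp]
      have h2 : 1 ≤ ‖(v : E)‖ ^ 2 := by nlinarith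
      nlinarith [mul_nonneg Real.pi_pos.le (mul_nonneg (sub_nonneg.2 ht) (sub_nonneg.2 h2))]

theorem IsSelfDual.kissingSum_eq (hU : IsSelfDual U) (hZ : IsSelfDual Z)
    (h : ∀ τ : ℂ, 0 < τ.im → latticeTheta U 0 τ ^ 8 - latticeTheta Z 0 τ ^ 8 = 0) :
    kissingSum U = kissingSum Z := by
  refine tendsto_nhds_unique hU.tendsto_kissingSum
    (hZ.tendsto_kissingSum.congr' ((eventually_gt_atTop 0).mono fun t ht => ?_))
  have h1 := sub_eq_zero.1 (h (Complex.I * t) (by simpa using ht))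
  rw [latticeTheta_I_mul, latticeTheta_I_mul] at h1
  have h2 := (pow_left_inj₀ (hU.tsum_exp_pos 0 ht).le (hZ.tsum_exp_pos 0 ht).le
    (by norm_num : (8 : ℕ) ≠ 0)).1 (by exact_mod_cast h1)
  simp only [h2]

omit [FiniteDimensional ℝ E] in
theorem IsSelfDual.eq_or_eq_neg_or_inner_eq_zero (hU : IsSelfDual U) {x y : E} (hx : x ∈ U)
    (hy : y ∈ U) (hx1 : ‖x‖ = 1) (hy1 : ‖y‖ = 1) : x = y ∨ x = -y ∨ ⟪x, y⟫ = 0 := by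
  obtain ⟨k, hk⟩ := hU.inner_int hx hy
  have h := abs_real_inner_le_norm x y
  rw [hx1, hy1, hk, mul_one] at h
  have h2 : |k| ≤ 1 := by exact_mod_cast h
  rw [abs_le] at h2
  obtain rfl | rfl | rfl : k = 1 ∨ k = -1 ∨ k = 0 := by omega
  · left
    rw [← inner_eq_one_iff_of_norm_eq_one (𝕜 := ℝ) hx1 hy1, hk]; simp
  · right; left
    rw [← inner_eq_one_iff_of_norm_eq_one (𝕜 := ℝ) hx1 (by rwa [norm_neg]), inner_neg_right, hk]
    simp
  · right; right
    simpa using hk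

theorem IsSelfDual.summable_kissingSum (hU : IsSelfDual U) :
    Summable ({v : U | ‖(v : E)‖ = 1}.indicator (1 : U → ℝ)) := by
  refine Summable.of_nonneg_of_le (fun v => Set.indicator_nonneg (fun _ _ => zero_le_one) v)
    (fun v => ?_) ((hU.summable_exp_neg Real.pi_pos).mul_left (Real.exp Real.pi))
  by_cases hv : ‖(v : E)‖ = 1
  · rw [Set.indicator_of_mem (show v ∈ {v : U | ‖(v : E)‖ = 1} from hv), hv, ← Real.exp_add]
    simp
  · rw [Set.indicator_of_notMem (show v ∉ {v : U | ‖(v : E)‖ = 1} from hv)]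
    positivity

theorem le_kissingSum_cubicLattice {ι : Type*} [Fintype ι] (b : OrthonormalBasis ι ℝ E) :
    2 * (Fintype.card ι : ℝ) ≤ kissingSum (cubicLattice b) := by
  classical
  let e : ι → cubicLattice b := fun i => ⟨b i, self_mem_cubicLattice b i⟩
  have he : Function.Injective e := fun i j h =>
    b.orthonormal.linearIndependent.injective (congrArg Subtype.val h)
  have hne : ∀ i j, e i ≠ -e j := fun i j h => by
    have h1 : b i = -b j := congrArg Subtype.val h
    have h2 : ⟪b i, b i⟫ = -⟪b i, b j⟫ := by rw [← inner_neg_right, ← h1]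
    simp only [orthonormal_iff_ite.1 b.orthonormal] at h2
    split_ifs at h2 <;> norm_num at h2
  let f : ι ⊕ ι ↪ cubicLattice b :=
    ⟨Sum.elim e fun i => -e i, he.sumElim (neg_injective.comp he) hne⟩
  have h := (isSelfDual_cubicLattice b).summable_kissingSum.sum_le_tsum (Finset.univ.map f)
    fun v _ => Set.indicator_nonneg (fun _ _ => zero_le_one) v
  refine le_trans (le_of_eq ?_) h
  rw [Finset.sum_map, Finset.sum_congr rfl (g := fun _ => (1 : ℝ))]
  · simp [two_mul]
  · rintro (i | i) -
    · refine Set.indicator_of_mem ?_ _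
      exact b.orthonormal.1 i
    · refine Set.indicator_of_mem ?_ _
      exact (norm_neg _).trans (b.orthonormal.1 i)

theorem IsSelfDual.le_span_of_kissingSum (hU : IsSelfDual U)
    (h : 2 * (Module.finrank ℝ E : ℝ) ≤ kissingSum U) :
    U ≤ Submodule.span ℤ {v | v ∈ U ∧ ⟪v, v⟫ = 1} := by
  classical
  obtain ⟨s, hs, hspan, hli⟩ := exists_linearIndependent ℝ {v | v ∈ U ∧ ‖v‖ = 1}
  have : Fintype s := hli.setFinite.fintype
  have hon : Orthonormal ℝ ((↑) : s → E) := by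
    refine ⟨fun i => (hs i.2).2, fun i j hij => ?_⟩
    rcases hU.eq_or_eq_neg_or_inner_eq_zero (hs i.2).1 (hs j.2).1 (hs i.2).2 (hs j.2).2
      with h1 | h1 | h1
    · exact absurd (Subtype.ext h1) hij
    · have h2 := linearIndependent_iff'.1 hli {i, j} (fun _ => 1)
        (by rw [Finset.sum_pair hij]; simp [h1]) i (by simp)
      exact absurd h2 one_ne_zero
    · exact h1
  have hR : ∀ v ∈ U, ‖v‖ = 1 → ∃ i : s, v = i ∨ v = -i := fun v hv hv1 => by
    by_contra! hcon
    have h1 : ∀ i ∈ s, ⟪i, v⟫ = 0 := fun i hi => by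
      rcases hU.eq_or_eq_neg_or_inner_eq_zero hv (hs hi).1 hv1 (hs hi).2 with h1 | h1 | h1
      · exact absurd h1 (hcon ⟨i, hi⟩).1
      · exact absurd h1 (hcon ⟨i, hi⟩).2
      · rw [real_inner_comm, h1]
    have h2 : v ∈ Submodule.span ℝ s := hspan ▸ Submodule.subset_span ⟨hv, hv1⟩
    have h3 : ⟪v, v⟫ = 0 := by
      refine Submodule.span_induction (p := fun x _ => ⟪x, v⟫ = 0) h1 (by simp)
        (fun x y _ _ hx hy => by rw [inner_add_left, hx, hy, add_zero])
        (fun a x _ hx => by rw [real_inner_smul_left, hx, mul_zero]) h2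
    rw [real_inner_self_eq_norm_sq, hv1] at h3
    norm_num at h3
  let e : s → U := fun i => ⟨i, (hs i.2).1⟩
  let T : Finset U := Finset.univ.image e ∪ Finset.univ.image fun i => -e i
  have hk : kissingSum U ≤ 2 * Fintype.card s := by
    rw [kissingSum, tsum_eq_sum (s := T)]
    · calc _ ≤ ∑ v ∈ T, (1 : ℝ) :=
            Finset.sum_le_sum fun v _ => Set.indicator_le' (fun _ _ => le_rfl)
              (fun _ _ => zero_le_one) v
        _ = (T.card : ℝ) := by simp
        _ ≤ ((Fintype.card s + Fintype.card s : ℕ) : ℝ) := by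
          refine Nat.cast_le.2 ((Finset.card_union_le _ _).trans ?_)
          exact add_le_add Finset.card_image_le Finset.card_image_le
        _ = _ := by push_cast; ring
    · intro v hv
      refine Set.indicator_of_notMem (fun hv1 => hv ?_) _
      obtain ⟨i, hi | hi⟩ := hR v v.2 hv1
      · exact Finset.mem_union_left _
          (Finset.mem_image.2 ⟨i, Finset.mem_univ _, Subtype.ext hi.symm⟩)
      · exact Finset.mem_union_right _
          (Finset.mem_image.2 ⟨i, Finset.mem_univ _, Subtype.ext hi.symm⟩)
  have hcard : Module.finrank ℝ E ≤ Fintype.card s := by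
    have : (Module.finrank ℝ E : ℝ) ≤ Fintype.card s := by linarith
    exact_mod_cast this
  have htop : Submodule.span ℝ (Set.range ((↑) : s → E)) = ⊤ :=
    hli.span_eq_top_of_card_eq_finrank' (le_antisymm hli.fintype_card_le_finrank hcard)
  let b := OrthonormalBasis.mk hon htop.ge
  intro x hx
  rw [← b.sum_repr' x]
  refine Submodule.sum_mem _ fun i _ => ?_
  have hb : b i = i := by simp [b]
  rw [hb]
  obtain ⟨k, hk⟩ := hU.inner_int (hs i.2).1 hx
  rw [hk, Int.cast_smul_eq_zsmul]
  refine Submodule.smul_mem _ _ (Submodule.subset_span ⟨(hs i.2).1, ?_⟩)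
  rw [real_inner_self_eq_norm_sq, (hs i.2).2, one_pow]

/-- Elkies' theorem: a unimodular lattice all of whose characteristic vectors have square at
least the rank is generated by its vectors of square one. -/
theorem IsSelfDual.le_span_of_le_isCharVec (hU : IsSelfDual U)
    (hUm : ∀ χ, IsCharVec U χ → (Module.finrank ℝ E : ℝ) ≤ ⟪χ, χ⟫) :
    U ≤ Submodule.span ℤ {v | v ∈ U ∧ ⟪v, v⟫ = 1} := by
  let b := stdOrthonormalBasis ℝ E
  have hZ := isSelfDual_cubicLattice b
  obtain ⟨ξ, hξ⟩ := hU.exists_isCharVec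
  have h1 := hU.latticeTheta_pow_eq hZ hξ (isCharVec_cubicLattice b) hUm
    fun χ hχ => by simpa using hχ.card_le_of_cubicLattice b
  refine hU.le_span_of_kissingSum ?_
  rw [hU.kissingSum_eq hZ h1]
  simpa using le_kissingSum_cubicLattice b

end Kissing

section Glue
variable {E F : Type*} [NormedAddCommGroup E] [InnerProductSpace ℝ E]
  [NormedAddCommGroup F] [InnerProductSpace ℝ F]

/-- A bimodular lattice, together with a representative `w` of the nontrivial class of its
discriminant group. -/
structure IsBimodularWith (L : Submodule ℤ E) (w : E) : Prop where
  span_top : Submodule.span ℝ (L : Set E) = ⊤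
  dual_iff : ∀ x, (∀ v ∈ L, ∃ k : ℤ, ⟪x, v⟫ = k) ↔ x ∈ L ∨ x - w ∈ L
  inner_self : ∃ k : ℤ, ⟪w, w⟫ = k + 1 / 2

/-- Gluing two bimodular lattices along the nontrivial classes of their discriminant groups. -/
def glue (L : Submodule ℤ E) (w : E) (M : Submodule ℤ F) (u : F) :
    Submodule ℤ (WithLp 2 (E × F)) where
  carrier := {z | ∃ k : ℤ, z.fst - k • w ∈ L ∧ z.snd - k • u ∈ M}
  zero_mem' := ⟨0, by simp⟩
  add_mem' {z z'} hz hz' := by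
    obtain ⟨k, h1, h2⟩ := hz
    obtain ⟨l, h3, h4⟩ := hz'
    refine ⟨k + l, ?_, ?_⟩
    · convert L.add_mem h1 h3 using 1
      rw [WithLp.add_fst]; module
    · convert M.add_mem h2 h4 using 1
      rw [WithLp.add_snd]; module
  smul_mem' c z hz := by
    obtain ⟨k, h1, h2⟩ := hz
    refine ⟨c * k, ?_, ?_⟩
    · convert L.smul_mem c h1 using 1
      rw [WithLp.smul_fst]; module
    · convert M.smul_mem c h2 using 1
      rw [WithLp.smul_snd]; module

variable {L : Submodule ℤ E} {w : E} {M : Submodule ℤ F} {u : F}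

omit [InnerProductSpace ℝ E] [InnerProductSpace ℝ F] in
theorem toLp_left_mem_glue {x : E} (hx : x ∈ L) : WithLp.toLp 2 (x, (0 : F)) ∈ glue L w M u :=
  ⟨0, by simpa using hx, by simp⟩

omit [InnerProductSpace ℝ E] [InnerProductSpace ℝ F] in
theorem toLp_right_mem_glue {y : F} (hy : y ∈ M) : WithLp.toLp 2 ((0 : E), y) ∈ glue L w M u :=
  ⟨0, by simp, by simpa using hy⟩

omit [InnerProductSpace ℝ E] [InnerProductSpace ℝ F] in
theorem toLp_mem_glue : WithLp.toLp 2 (w, u) ∈ glue L w M u :=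
  ⟨1, by simp, by simp⟩

namespace IsBimodularWith

theorem inner_int (hL : IsBimodularWith L w) {x v : E} (hx : x ∈ L) (hv : v ∈ L) :
    ∃ k : ℤ, ⟪x, v⟫ = k :=
  (hL.dual_iff x).2 (Or.inl hx) v hv

theorem inner_glue_int (hL : IsBimodularWith L w) {v : E} (hv : v ∈ L) :
    ∃ k : ℤ, ⟪w, v⟫ = k :=
  (hL.dual_iff w).2 (Or.inr (by simp)) v hv

theorem two_smul_mem (hL : IsBimodularWith L w) : (2 : ℤ) • w ∈ L := by
  have h : ∀ v ∈ L, ∃ k : ℤ, ⟪(2 : ℤ) • w, v⟫ = k := fun v hv => by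
    obtain ⟨k, hk⟩ := hL.inner_glue_int hv
    refine ⟨2 * k, ?_⟩
    rw [← Int.cast_smul_eq_zsmul ℝ, real_inner_smul_left, hk]
    push_cast; rfl
  rcases (hL.dual_iff _).1 h with h | h
  · exact h
  · rw [two_smul, add_sub_cancel_right] at h
    exact L.smul_mem 2 h

theorem inner_eq (hL : IsBimodularWith L w) {x x' : E} {k k' : ℤ} (hx : x - k • w ∈ L)
    (hx' : x' - k' • w ∈ L) : ∃ l : ℤ, ⟪x, x'⟫ = l + k * k' * ⟪w, w⟫ := by
  obtain ⟨a, ha⟩ := hL.inner_int hx hx'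
  obtain ⟨b, hb⟩ := hL.inner_glue_int hx
  obtain ⟨c, hc⟩ := hL.inner_glue_int hx'
  refine ⟨a + k' * b + k * c, ?_⟩
  have h1 : x = (x - k • w) + (k : ℝ) • w := by rw [Int.cast_smul_eq_zsmul]; abel
  have h2 : x' = (x' - k' • w) + (k' : ℝ) • w := by rw [Int.cast_smul_eq_zsmul]; abel
  rw [real_inner_comm] at hb
  conv_lhs => rw [h1, h2]
  rw [inner_add_left, inner_add_right, inner_add_right, real_inner_smul_left,
    real_inner_smul_right, real_inner_smul_left, real_inner_smul_right, ha, hb, hc]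
  push_cast
  ring

theorem isSelfDual_glue (hL : IsBimodularWith L w) (hM : IsBimodularWith M u) :
    IsSelfDual (glue L w M u) where
  span_top := by
    rw [eq_top_iff]
    intro z _
    have h1 : WithLp.toLp 2 (z.fst, (0 : F)) ∈
        Submodule.span ℝ (glue L w M u : Set (WithLp 2 (E × F))) := by
      refine Submodule.span_induction (p := fun x _ => WithLp.toLp 2 (x, (0 : F)) ∈
        Submodule.span ℝ (glue L w M u : Set (WithLp 2 (E × F))))
        (fun x hx => Submodule.subset_span (toLp_left_mem_glue hx)) (Submodule.zero_mem _)
        (fun x y _ _ hx hy => ?_) (fun a x _ hx => ?_)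
        (show z.fst ∈ Submodule.span ℝ (L : Set E) from hL.span_top ▸ Submodule.mem_top)
      · convert Submodule.add_mem _ hx hy using 1
        rw [← WithLp.toLp_add]; simp
      · convert Submodule.smul_mem _ a hx using 1
        rw [← WithLp.toLp_smul]; simp
    have h2 : WithLp.toLp 2 ((0 : E), z.snd) ∈
        Submodule.span ℝ (glue L w M u : Set (WithLp 2 (E × F))) := by
      refine Submodule.span_induction (p := fun x _ => WithLp.toLp 2 ((0 : E), x) ∈
        Submodule.span ℝ (glue L w M u : Set (WithLp 2 (E × F))))
        (fun x hx => Submodule.subset_span (toLp_right_mem_glue hx)) (Submodule.zero_mem _)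
        (fun x y _ _ hx hy => ?_) (fun a x _ hx => ?_)
        (show z.snd ∈ Submodule.span ℝ (M : Set F) from hM.span_top ▸ Submodule.mem_top)
      · convert Submodule.add_mem _ hx hy using 1
        rw [← WithLp.toLp_add]; simp
      · convert Submodule.smul_mem _ a hx using 1
        rw [← WithLp.toLp_smul]; simp
    convert Submodule.add_mem _ h1 h2 using 1
    rw [← WithLp.toLp_add]
    simp
    rfl
  mem_iff z := by
    obtain ⟨p, hp⟩ := hL.inner_self
    obtain ⟨q, hq⟩ := hM.inner_self
    constructor
    · rintro ⟨k, h1, h2⟩ z' ⟨k', h3, h4⟩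
      obtain ⟨a, ha⟩ := hL.inner_eq h1 h3
      obtain ⟨b, hb⟩ := hM.inner_eq h2 h4
      refine ⟨a + b + k * k' * (p + q + 1), ?_⟩
      rw [WithLp.prod_inner_apply]
      refine (congrArg₂ (· + ·) ha hb).trans ?_
      rw [hp, hq]
      push_cast
      ring
    · intro h
      have h1 := (hL.dual_iff z.fst).1 fun v hv => by
        simpa [WithLp.prod_inner_apply] using h _ (toLp_left_mem_glue hv)
      have h2 := (hM.dual_iff z.snd).1 fun v hv => by
        simpa [WithLp.prod_inner_apply] using h _ (toLp_right_mem_glue hv)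
      have h1' : ∃ k : ℤ, (k = 0 ∨ k = 1) ∧ z.fst - k • w ∈ L := by
        rcases h1 with h1 | h1
        · exact ⟨0, Or.inl rfl, by simpa using h1⟩
        · exact ⟨1, Or.inr rfl, by simpa using h1⟩
      have h2' : ∃ k : ℤ, (k = 0 ∨ k = 1) ∧ z.snd - k • u ∈ M := by
        rcases h2 with h2 | h2
        · exact ⟨0, Or.inl rfl, by simpa using h2⟩
        · exact ⟨1, Or.inr rfl, by simpa using h2⟩
      obtain ⟨k, hk, h1⟩ := h1'
      obtain ⟨l, hl, h2⟩ := h2'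
      obtain ⟨a, ha⟩ := hL.inner_eq h1 (x' := w) (k' := 1) (by simp)
      obtain ⟨b, hb⟩ := hM.inner_eq h2 (x' := u) (k' := 1) (by simp)
      obtain ⟨c, hc⟩ := h _ toLp_mem_glue
      rw [WithLp.prod_inner_apply] at hc
      have hd : (a : ℝ) + k * (p + 1 / 2) + (b + l * (q + 1 / 2)) = c := by
        rw [← hp, ← hq, ← hc]
        refine Eq.trans ?_ (congrArg₂ (· + ·) ha hb).symm
        push_cast
        ring
      have hd' : 2 * a + k * (2 * p + 1) + (2 * b + l * (2 * q + 1)) = 2 * c := by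
        have : (2 * a + k * (2 * p + 1) + (2 * b + l * (2 * q + 1)) : ℝ) = 2 * c := by
          linear_combination 2 * hd
        exact_mod_cast this
      have hkl : k = l := by
        rcases hk with rfl | rfl <;> rcases hl with rfl | rfl <;> omega
      exact ⟨k, h1, hkl ▸ h2⟩

end IsBimodularWith
end Glue

section RootLattice
variable {E : Type*} [NormedAddCommGroup E] [InnerProductSpace ℝ E]

theorem inner_eq_mul (a b : ℝ) : ⟪a, b⟫ = a * b := by
  simp [mul_comm]

/-- The root lattice `A₁`. -/
theorem isBimodularWith_A1 :
    IsBimodularWith (Submodule.span ℤ {Real.sqrt 2}) (Real.sqrt 2 / 2) := by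
  have h2 : Real.sqrt 2 * Real.sqrt 2 = 2 := Real.mul_self_sqrt (by norm_num)
  have h0 : Real.sqrt 2 ≠ 0 := by positivity
  refine ⟨?_, fun x => ?_, 0, ?_⟩
  · rw [eq_top_iff]
    intro x _
    have : x = (x / Real.sqrt 2) • Real.sqrt 2 := by simp [h0]
    rw [this]
    exact Submodule.smul_mem _ _ (Submodule.subset_span (Submodule.mem_span_singleton_self _))
  · simp only [Submodule.mem_span_singleton, zsmul_eq_mul]
    constructor
    · intro h
      obtain ⟨k, hk⟩ := h _ ⟨1, rfl⟩
      have hk' : x = k * (Real.sqrt 2 / 2) := by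
        refine mul_right_cancel₀ h0 ?_
        rw [inner_eq_mul, Int.cast_one, one_mul] at hk
        linear_combination hk - (k : ℝ) / 2 * h2
      rcases Int.even_or_odd' k with ⟨l, rfl | rfl⟩
      · left; exact ⟨l, by rw [hk']; push_cast; ring⟩
      · right; exact ⟨l, by rw [hk']; push_cast; ring⟩
    · rintro (⟨k, hk⟩ | ⟨k, hk⟩) _ ⟨l, rfl⟩
      · refine ⟨2 * k * l, ?_⟩
        rw [inner_eq_mul, ← hk]
        push_cast
        linear_combination (k * l : ℝ) * h2
      · refine ⟨(2 * k + 1) * l, ?_⟩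
        rw [show x = k * Real.sqrt 2 + Real.sqrt 2 / 2 by rw [hk]; ring, inner_eq_mul]
        push_cast
        linear_combination (k * l + l / 2 : ℝ) * h2
  · rw [inner_eq_mul, Int.cast_zero]
    linear_combination h2 / 4

variable {L : Submodule ℤ E} {w : E} {ξ : E}

theorem IsBimodularWith.inner_char_glue_int (hL : IsBimodularWith L w)
    (hξ : ∀ v ∈ L, ∃ k : ℤ, ⟪ξ, v⟫ - ⟪v, v⟫ = 2 * k) : ∃ k : ℤ, ⟪ξ, w⟫ = k := by
  obtain ⟨k, hk⟩ := hξ _ hL.two_smul_mem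
  obtain ⟨p, hp⟩ := hL.inner_self
  refine ⟨k + 2 * p + 1, ?_⟩
  rw [← Int.cast_smul_eq_zsmul ℝ, real_inner_smul_right, real_inner_smul_right,
    real_inner_smul_left, hp] at hk
  push_cast at hk ⊢
  linarith

theorem IsBimodularWith.char_mem (hL : IsBimodularWith L w)
    (hξ : ∀ v ∈ L, ∃ k : ℤ, ⟪ξ, v⟫ - ⟪v, v⟫ = 2 * k) : ξ ∈ L := by
  obtain ⟨k, hk⟩ := hL.inner_char_glue_int hξ
  rcases (hL.dual_iff ξ).1 (fun v hv => by
    obtain ⟨a, ha⟩ := hξ v hv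
    obtain ⟨b, hb⟩ := hL.inner_int hv hv
    exact ⟨2 * a + b, by push_cast; linarith⟩) with h | h
  · exact h
  · exfalso
    obtain ⟨l, hl⟩ := hL.inner_glue_int h
    obtain ⟨p, hp⟩ := hL.inner_self
    rw [inner_sub_right, real_inner_comm, hk, hp] at hl
    have : (2 * k - 2 * p - 1 : ℝ) = 2 * l := by linarith
    have h2 : 2 * k - 2 * p - 1 = 2 * l := by exact_mod_cast this
    omega

variable [FiniteDimensional ℝ E]

/-- The square of a characteristic covector of a bimodular lattice is congruent to the rank
plus or minus one modulo `8`. -/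
theorem IsBimodularWith.norm_char (hL : IsBimodularWith L w)
    (hξ : ∀ v ∈ L, ∃ k : ℤ, ⟪ξ, v⟫ - ⟪v, v⟫ = 2 * k) :
    (∃ k : ℤ, ⟪ξ, ξ⟫ = Module.finrank ℝ E + 1 + 8 * k) ∨
      ∃ k : ℤ, ⟪ξ, ξ⟫ = Module.finrank ℝ E - 1 + 8 * k := by
  have h2 : Real.sqrt 2 * Real.sqrt 2 = 2 := Real.mul_self_sqrt (by norm_num)
  obtain ⟨b, hb⟩ := hL.inner_char_glue_int hξ
  obtain ⟨c, hc⟩ := hL.inner_self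
  obtain ⟨ε, hε, j, hj⟩ : ∃ ε : ℤ, (ε = 0 ∨ ε = 1) ∧ ∃ j : ℤ, b + ε - c - 1 = 2 * j := by
    rcases Int.even_or_odd' (b - c - 1) with ⟨j, hj | hj⟩
    · exact ⟨0, Or.inl rfl, j, by omega⟩
    · exact ⟨1, Or.inr rfl, j + 1, by omega⟩
  have hU := hL.isSelfDual_glue isBimodularWith_A1
  have hχ : IsCharVec (glue L w (Submodule.span ℤ {Real.sqrt 2}) (Real.sqrt 2 / 2))
      (WithLp.toLp 2 (ξ, (ε : ℝ) * Real.sqrt 2)) := by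
    refine ⟨⟨0, by simpa using hL.char_mem hξ, ?_⟩, ?_⟩
    · simp [Submodule.mem_span_singleton]
    · rintro z ⟨k, hz1, hz2⟩
      obtain ⟨l, hl⟩ := Submodule.mem_span_singleton.1 hz2
      simp only [zsmul_eq_mul] at hl
      obtain ⟨a, ha⟩ := hξ _ hz1
      obtain ⟨d, hd⟩ := hL.inner_glue_int hz1
      have hx : z.fst = (z.fst - k • w) + (k : ℝ) • w := by
        rw [Int.cast_smul_eq_zsmul]; abel
      have hy : z.snd = l * Real.sqrt 2 + k * (Real.sqrt 2 / 2) := by rw [hl]; ring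
      obtain ⟨e, he⟩ := Int.even_mul_succ_self (k - 1)
      have he' : k * k = k + 2 * e := by linear_combination he
      have he2 : (k * k : ℝ) = k + 2 * e := by exact_mod_cast he'
      have hj2 : (b + ε - c - 1 : ℝ) = 2 * j := by exact_mod_cast hj
      refine ⟨a + k * j + ε * l - k * d - e * (c + 1) - l * l - l * k, ?_⟩
      have h3 : ⟪ξ, z.fst⟫ - ⟪z.fst, z.fst⟫ = 2 * a + k * b - 2 * k * d - k * k * (c + 1 / 2) := by
        generalize z.fst - k • w = x at *
        rw [hx, inner_add_add_self]
        simp only [inner_add_right, real_inner_smul_right, real_inner_smul_left]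
        rw [real_inner_comm w x, hd, hc, hb]
        linear_combination ha
      rw [WithLp.prod_inner_apply, WithLp.prod_inner_apply]
      have h4 : ⟪(ε : ℝ) * Real.sqrt 2, z.snd⟫ - ⟪z.snd, z.snd⟫ =
          2 * ε * l + ε * k - 2 * l * l - 2 * l * k - k * k / 2 := by
        rw [hy, inner_eq_mul, inner_eq_mul]
        linear_combination (ε * l + ε * k / 2 - l * l - l * k - k * k / 4 : ℝ) * h2
      change ⟪ξ, z.fst⟫ + ⟪(ε : ℝ) * Real.sqrt 2, z.snd⟫ - (⟪z.fst, z.fst⟫ + ⟪z.snd, z.snd⟫) = _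
      push_cast
      linear_combination h3 + h4 + (k : ℝ) * hj2 - (c + 1 : ℝ) * he2
  obtain ⟨k, hk⟩ := hχ.norm_modEq hU
  have hfin : Module.finrank ℝ (WithLp 2 (E × ℝ)) = Module.finrank ℝ E + 1 := by
    rw [(WithLp.linearEquiv 2 ℝ (E × ℝ)).finrank_eq, Module.finrank_prod, Module.finrank_self]
  rw [WithLp.prod_inner_apply, hfin] at hk
  have hk' : ⟪ξ, ξ⟫ + 2 * (ε * ε) = Module.finrank ℝ E + 1 + 8 * k := by
    rw [Nat.cast_add, Nat.cast_one] at hk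
    rw [← hk]
    change _ = ⟪ξ, ξ⟫ + ⟪(ε : ℝ) * Real.sqrt 2, (ε : ℝ) * Real.sqrt 2⟫
    rw [inner_eq_mul]
    linear_combination -(ε * ε : ℝ) * h2
  rcases hε with rfl | rfl
  · left; exact ⟨k, by push_cast at hk'; linarith⟩
  · right; exact ⟨k, by push_cast at hk'; linarith⟩

/-- A bimodular lattice without vectors of square one whose characteristic covectors are long
is generated, up to index a power of two, by its roots. -/
theorem IsBimodularWith.mem_span_half_roots (hL : IsBimodularWith L w)
    (hmin : ∀ v ∈ L, ⟪v, v⟫ ≠ 1) {p q : ℝ} (hpq : p + q = 0)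
    (hp : ∀ ξ, (∀ v ∈ L, ∃ k : ℤ, ⟪ξ, v⟫ - ⟪v, v⟫ = 2 * k) →
      (∃ k : ℤ, ⟪ξ, ξ⟫ = Module.finrank ℝ E + 1 + 8 * k) → Module.finrank ℝ E + p ≤ ⟪ξ, ξ⟫)
    (hq : ∀ ξ, (∀ v ∈ L, ∃ k : ℤ, ⟪ξ, v⟫ - ⟪v, v⟫ = 2 * k) →
      (∃ k : ℤ, ⟪ξ, ξ⟫ = Module.finrank ℝ E - 1 + 8 * k) → Module.finrank ℝ E + q ≤ ⟪ξ, ξ⟫)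
    {v : E} (hv : v ∈ L) :
    v ∈ Submodule.span ℤ {x | (2 : ℤ) • x ∈ L ∧ ⟪x, x⟫ = 1 / 2} := by
  have hU := hL.isSelfDual_glue hL
  have hfin : Module.finrank ℝ (WithLp 2 (E × E)) = Module.finrank ℝ E + Module.finrank ℝ E := by
    rw [(WithLp.linearEquiv 2 ℝ (E × E)).finrank_eq, Module.finrank_prod]
  have hlong : ∀ χ, IsCharVec (glue L w L w) χ →
      (Module.finrank ℝ (WithLp 2 (E × E)) : ℝ) ≤ ⟪χ, χ⟫ := fun χ hχ => by
    obtain ⟨m, hm⟩ := hχ.norm_modEq hU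
    have h1 : ∀ v ∈ L, ∃ k : ℤ, ⟪χ.fst, v⟫ - ⟪v, v⟫ = 2 * k := fun v hv => by
      simpa [WithLp.prod_inner_apply] using hχ.2 _ (toLp_left_mem_glue hv)
    have h2 : ∀ v ∈ L, ∃ k : ℤ, ⟪χ.snd, v⟫ - ⟪v, v⟫ = 2 * k := fun v hv => by
      simpa [WithLp.prod_inner_apply] using hχ.2 _ (toLp_right_mem_glue hv)
    have hs : ⟪χ, χ⟫ = ⟪χ.fst, χ.fst⟫ + ⟪χ.snd, χ.snd⟫ := WithLp.prod_inner_apply _ _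
    rw [hs, hfin] at hm ⊢
    push_cast at hm ⊢
    rcases hL.norm_char h1 with ⟨k, hk⟩ | ⟨k, hk⟩ <;> rcases hL.norm_char h2 with ⟨l, hl⟩ | ⟨l, hl⟩
    · exfalso
      have : (2 + 8 * k + 8 * l : ℝ) = 8 * m := by linarith
      have : 2 + 8 * k + 8 * l = 8 * m := by exact_mod_cast this
      omega
    · linarith [hp _ h1 ⟨k, hk⟩, hq _ h2 ⟨l, hl⟩]
    · linarith [hq _ h1 ⟨k, hk⟩, hp _ h2 ⟨l, hl⟩]
    · exfalso
      have : (-2 + 8 * k + 8 * l : ℝ) = 8 * m := by linarith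
      have : -2 + 8 * k + 8 * l = 8 * m := by exact_mod_cast this
      omega
  have hspan := hU.le_span_of_le_isCharVec hlong (toLp_left_mem_glue hv)
  refine Submodule.span_induction
    (p := fun z _ => z.fst ∈ Submodule.span ℤ {x | (2 : ℤ) • x ∈ L ∧ ⟪x, x⟫ = 1 / 2})
    ?_ (Submodule.zero_mem _) (fun x y _ _ hx hy => ?_) (fun a x _ hx => ?_) hspan
  · rintro z ⟨⟨k, h1, h2⟩, hz⟩
    rw [WithLp.prod_inner_apply] at hz
    change ⟪z.fst, z.fst⟫ + ⟪z.snd, z.snd⟫ = 1 at hz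
    obtain ⟨c, hc⟩ := hL.inner_self
    obtain ⟨a, ha⟩ := hL.inner_eq h1 h1
    obtain ⟨b, hb⟩ := hL.inner_eq h2 h2
    rw [hc] at ha hb
    have hx0 : 0 ≤ ⟪z.fst, z.fst⟫ := real_inner_self_nonneg
    have hy0 : 0 ≤ ⟪z.snd, z.snd⟫ := real_inner_self_nonneg
    have hmem : ∀ {x : E} {l : ℤ}, x - (2 * l) • w ∈ L → x ∈ L := fun {x l} h => by
      have := L.add_mem h (L.smul_mem l hL.two_smul_mem)
      rwa [smul_smul, mul_comm l 2, sub_add_cancel] at this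
    rcases Int.even_or_odd' k with ⟨l, rfl | rfl⟩
    · exfalso
      obtain ⟨e, he⟩ := hL.inner_int (hmem h1) (hmem h1)
      obtain ⟨f, hf⟩ := hL.inner_int (hmem h2) (hmem h2)
      have hef : e + f = 1 := by rw [he, hf] at hz; exact_mod_cast hz
      have he0 : 0 ≤ e := by rw [he] at hx0; exact_mod_cast hx0
      have hf0 : 0 ≤ f := by rw [hf] at hy0; exact_mod_cast hy0
      rcases (by omega : e = 1 ∨ f = 1) with rfl | rfl
      · exact hmin _ (hmem h1) (by simpa using he)
      · exact hmin _ (hmem h2) (by simpa using hf)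
    · refine Submodule.subset_span ⟨?_, ?_⟩
      · have := L.add_mem (L.smul_mem 2 h1) (L.smul_mem (2 * l + 1) hL.two_smul_mem)
        convert this using 1
        module
      · set g : ℤ := 4 * l * l + 4 * l with hg
        have ha' : ⟪z.fst, z.fst⟫ = (a + g * c + c + 2 * l * l + 2 * l : ℤ) + 1 / 2 := by
          rw [ha]; push_cast [hg]; ring
        have hb' : ⟪z.snd, z.snd⟫ = (b + g * c + c + 2 * l * l + 2 * l : ℤ) + 1 / 2 := by
          rw [hb]; push_cast [hg]; ring
        generalize a + g * c + c + 2 * l * l + 2 * l = e at ha'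
        generalize b + g * c + c + 2 * l * l + 2 * l = f at hb'
        rw [ha', hb'] at hz
        rw [ha'] at hx0
        rw [hb'] at hy0
        have hef : e + f = 0 := by
          have : (e + f : ℝ) = 0 := by linarith
          exact_mod_cast this
        have he : -1 < e := by
          have : (-1 : ℝ) < e := by linarith
          exact_mod_cast this
        have hf : -1 < f := by
          have : (-1 : ℝ) < f := by linarith
          exact_mod_cast this
        obtain rfl : e = 0 := by omega
        rw [ha']
        simp
  · rw [WithLp.add_fst]; exact Submodule.add_mem _ hx hy
  · rw [WithLp.smul_fst]; exact Submodule.smul_mem _ _ hx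

end RootLattice

section EuclideanLattice

/-- A lattice of Euclidean space as a submodule. -/
def IsLattice.toSubmodule {n : ℕ} {L : Set (EuclideanSpace ℝ (Fin n))} (hL : IsLattice L) :
    Submodule ℤ (EuclideanSpace ℝ (Fin n)) :=
  AddSubgroup.toIntSubmodule
    { carrier := L
      zero_mem' := hL.1.1
      add_mem' := fun {x y} hx hy => hL.1.2.1 x hx y hy
      neg_mem' := fun {x} hx => hL.1.2.2 x hx }

theorem IsLattice.mem_toSubmodule {n : ℕ} {L : Set (EuclideanSpace ℝ (Fin n))} (hL : IsLattice L)
    {x : EuclideanSpace ℝ (Fin n)} : x ∈ hL.toSubmodule ↔ x ∈ L := Iff.rfl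

/-- A lattice equals its double dual. -/
theorem IsLattice.dualSet_dualSet_subset {n : ℕ} {L : Set (EuclideanSpace ℝ (Fin n))}
    (hL : IsLattice L) : dualSet (dualSet L) ⊆ L := by
  intro x hx
  obtain ⟨b, hbL, -, hb⟩ := hL.2.1
  have hspan : ⊤ ≤ Submodule.span ℝ (Set.range b) := by
    rw [← hL.2.2.1, Submodule.span_le]
    intro v hv
    obtain ⟨c, rfl⟩ := hb v hv
    exact Submodule.sum_mem _ fun i _ =>
      Submodule.smul_mem _ _ (Submodule.subset_span ⟨i, rfl⟩)
  let B := basisOfTopLeSpanOfCardEqFinrank b hspan (by simp)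
  have hB : ∀ i, B i = b i := fun i => by simp [B]
  obtain ⟨b', hb'⟩ := exists_dual_family B
  have hb'L : ∀ i, b' i ∈ dualSet L := fun i v hv => by
    obtain ⟨c, rfl⟩ := hb v hv
    refine ⟨c i, ?_⟩
    rw [hb', ← B.equivFun_apply, map_sum]
    simp [← hB, Finsupp.single_apply]
  rw [← B.sum_repr x]
  change _ ∈ hL.toSubmodule
  refine Submodule.sum_mem _ fun i _ => ?_
  obtain ⟨k, hk⟩ := hx _ (hb'L i)
  rw [← hb', real_inner_comm, hk, Int.cast_smul_eq_zsmul, hB]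
  exact Submodule.smul_mem _ _ (hL.mem_toSubmodule.2 (hbL i))

theorem IsBimodular.exists_isBimodularWith {n : ℕ} {L : Set (EuclideanSpace ℝ (Fin n))}
    (hL : IsBimodular L) : ∃ w, IsBimodularWith hL.1.toSubmodule w := by
  obtain ⟨hlat, w, ⟨hw, hwL⟩, hdual⟩ := hL
  have hmem : ∀ {x}, x ∈ hlat.toSubmodule ↔ x ∈ L := hlat.mem_toSubmodule
  refine ⟨w, hlat.2.2.1, fun x => ⟨fun h => hdual x h, ?_⟩, ?_⟩
  · rintro (h | h) v hv
    · exact hlat.2.2.2 x h v hv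
    · obtain ⟨k, hk⟩ := hlat.2.2.2 _ h v hv
      obtain ⟨l, hl⟩ := hw v hv
      refine ⟨k + l, ?_⟩
      rw [inner_sub_left, hl] at hk
      push_cast
      linarith
  · have h2w : (2 : ℝ) • w ∈ L := by
      refine (hdual _ fun v hv => ?_).resolve_right fun h => hwL ?_
      · obtain ⟨l, hl⟩ := hw v hv
        exact ⟨2 * l, by rw [real_inner_smul_left, hl]; push_cast; rfl⟩
      · rwa [two_smul, add_sub_cancel_right] at h
    obtain ⟨k, hk⟩ := hw _ h2w
    rw [real_inner_smul_right] at hk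
    rcases Int.even_or_odd' k with ⟨l, rfl | rfl⟩
    · exfalso
      refine hwL (hlat.dualSet_dualSet_subset fun x hx => ?_)
      rcases hdual x hx with h | h
      · exact hw x h
      · obtain ⟨a, ha⟩ := hw _ h
        rw [inner_sub_right] at ha
        push_cast at hk
        exact ⟨a + l, by push_cast; linarith⟩
    · exact ⟨l, by push_cast at hk; linarith⟩

theorem defectSign_le {n : ℕ} {L : Set (EuclideanSpace ℝ (Fin n))} {ε : ℤ}
    {ξ : EuclideanSpace ℝ (Fin n)} (hξ : ξ ∈ CharSign L ε) :
    n + 4 * defectSign L ε ≤ ⟪ξ, ξ⟫ := by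
  have h : defectSign L ε ≤ (⟪ξ, ξ⟫ - n) / 4 := by
    refine csInf_le ⟨-n / 4, ?_⟩ ⟨ξ, hξ, rfl⟩
    rintro _ ⟨χ, -, rfl⟩
    have : 0 ≤ ⟪χ, χ⟫ := real_inner_self_nonneg
    simp only
    linarith
  linarith

theorem IsLattice.mem_charSet {n : ℕ} {L : Set (EuclideanSpace ℝ (Fin n))} (hL : IsLattice L)
    {ξ : EuclideanSpace ℝ (Fin n)} (hξ : ∀ v ∈ L, ∃ k : ℤ, ⟪ξ, v⟫ - ⟪v, v⟫ = 2 * k) :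
    ξ ∈ CharSet L := by
  refine ⟨fun v hv => ?_, hξ⟩
  obtain ⟨a, ha⟩ := hξ v hv
  obtain ⟨b, hb⟩ := hL.2.2.2 v hv v hv
  exact ⟨2 * a + b, by push_cast; linarith⟩

end EuclideanLattice

/-- a minimal bimodular lattice `L` with `d_+(L) + d_−(L) = 0` is a root lattice:
it is spanned over `ℚ` by its vectors of square 2. -/
theorem stmt11 {n : ℕ} (L : Set (EuclideanSpace ℝ (Fin n))) (hL : IsBimodular L)
    (hmin : ∀ v ∈ L, ⟪v, v⟫ ≠ 1)
    (hd : defectSign L 1 + defectSign L (-1) = 0) :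
    ∀ v ∈ L, v ∈ Submodule.span ℚ {u | u ∈ L ∧ ⟪u, u⟫ = 2} := by
  obtain ⟨w, hw⟩ := hL.exists_isBimodularWith
  intro v hv
  have h := hw.mem_span_half_roots hmin
    (show 4 * defectSign L 1 + 4 * defectSign L (-1) = 0 by linarith)
    (fun ξ hξ hk => by
      rw [finrank_euclideanSpace_fin] at hk ⊢
      exact defectSign_le ⟨hL.1.mem_charSet hξ, by simpa using hk⟩)
    (fun ξ hξ hk => by
      rw [finrank_euclideanSpace_fin] at hk ⊢
      exact defectSign_le ⟨hL.1.mem_charSet hξ, by simpa [← sub_eq_add_neg] using hk⟩)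
    (hL.1.mem_toSubmodule.2 hv)
  refine Submodule.span_induction (p := fun x _ => x ∈ Submodule.span ℚ {u | u ∈ L ∧ ⟪u, u⟫ = 2})
    ?_ (Submodule.zero_mem _) (fun x y _ _ hx hy => Submodule.add_mem _ hx hy)
    (fun a x _ hx => ?_) h
  · rintro x ⟨hx, hx2⟩
    have h1 : (2 : ℤ) • x ∈ Submodule.span ℚ {u | u ∈ L ∧ ⟪u, u⟫ = 2} := by
      refine Submodule.subset_span ⟨hx, ?_⟩
      rw [← Int.cast_smul_eq_zsmul ℝ, real_inner_smul_left, real_inner_smul_right, hx2]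
      norm_num
    have h2 : x = (1 / 2 : ℚ) • (2 : ℤ) • x := by
      rw [← Int.cast_smul_eq_zsmul ℚ, smul_smul]
      norm_num
    rw [h2]
    exact Submodule.smul_mem _ _ h1
  · rw [← Int.cast_smul_eq_zsmul ℚ]
    exact Submodule.smul_mem _ _ hx
end
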